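/- arXiv:2512.17823 — 3 statements merged into one kernel-verified Lean document; each statement's English description precedes it below -/
import Mathlib

section
/- Let X : ℤ² → ℝ be vertex weights and let u₁,…,u_k, v₁,…,v_k ∈ ℤ² satisfy: for all i,j ∈ {1,…,k}, u_i ≤ v_j coordinatewise, and for all i ≠ j every up-right path from u_i to v_j shares a vertex with every up-right path from u_j to v_i. Then T([u₁,…,u_k],[v₁,…,v_k]) = det( T₁(u_i, v_j) )_{i,j=1}^k. -/
open scoped BigOperators

/-! ### Directed paths and partition functions -/

/-- One step of an up-right path in `ℤ²`: one coordinate increases by `1`. -/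
def UpStep (p q : ℤ × ℤ) : Prop :=
  (q.1 = p.1 + 1 ∧ q.2 = p.2) ∨ (q.1 = p.1 ∧ q.2 = p.2 + 1)

/-- `γ` is a directed path from `u` to `v` for the step relation `E`. -/
def IsDirPath {α : Type*} (E : α → α → Prop) (γ : List α) (u v : α) : Prop :=
  γ.head? = some u ∧ γ.getLast? = some v ∧ γ.Chain' E

/-- Tuples of pairwise vertex-disjoint directed paths, the `i`-th from `u i` to `v i`. -/
def DisjointPathTuples {α : Type*} (E : α → α → Prop) {k : ℕ} (u v : Fin k → α) :
    Set (Fin k → List α) :=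
  {γ | (∀ i, IsDirPath E (γ i) (u i) (v i)) ∧ ∀ i j, i ≠ j → ∀ w ∈ γ i, w ∉ γ j}

/-- The product of the vertex weights over all vertices lying on some path of the tuple. -/
noncomputable def tupleWeight {α : Type*} [DecidableEq α] (Y : α → ℝ) {k : ℕ}
    (γ : Fin k → List α) : ℝ :=
  ∏ w ∈ Finset.univ.biUnion (fun i => (γ i).toFinset), Y w

/-- The `k`-path partition function in the directed graph with step relation `E` and
vertex weights `Y` (an empty sum is `0`; there are only finitely many relevant paths,
so the `tsum` below is a finite sum). -/
noncomputable def dirPF {α : Type*} [DecidableEq α] (E : α → α → Prop) (Y : α → ℝ) {k : ℕ}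
    (u v : Fin k → α) : ℝ :=
  ∑' γ : DisjointPathTuples E u v, tupleWeight Y (γ : Fin k → List α)

/-- The `k`-path partition function `T([u₁,…,u_k],[v₁,…,v_k])` for vertex weights `X` on `ℤ²`. -/
noncomputable def TT (X : ℤ × ℤ → ℝ) {k : ℕ} (u v : Fin k → ℤ × ℤ) : ℝ :=
  dirPF UpStep X u v

/-- The one-path partition function `T₁(u,v)`. -/
noncomputable def T1 (X : ℤ × ℤ → ℝ) (u v : ℤ × ℤ) : ℝ :=
  TT X (fun _ : Fin 1 => u) (fun _ : Fin 1 => v)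

/-- `T_k(u,v)`, with `T_0(u,v) = 1`: the `i`-th path goes from `u + (i-1,0)` to `v + (i-k,0)`,
`i = 1,…,k`. -/
noncomputable def Tk (X : ℤ × ℤ → ℝ) (k : ℕ) (u v : ℤ × ℤ) : ℝ :=
  if k = 0 then 1
  else TT X (fun i : Fin k => (u.1 + (i : ℕ), u.2))
    (fun i : Fin k => (v.1 + (i : ℕ) - (k - 1 : ℤ), v.2))

/-- `Z_j(u,v) = T_j(u,v)/T_{j-1}(u,v)` when `T_{j-1}(u,v) > 0`, and `0` otherwise. -/
noncomputable def Zj (X : ℤ × ℤ → ℝ) (j : ℤ) (u v : ℤ × ℤ) : ℝ :=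
  if 0 < Tk X (j - 1).toNat u v then Tk X j.toNat u v / Tk X (j - 1).toNat u v else 0

/-- `Z^{m,n}_j(i)`: equal to `Z_j((1,1),(i,n))` for `i ≤ m` and to `Z_j((1,i-m),(m,n))`
for `i > m`. -/
noncomputable def Zmn (X : ℤ × ℤ → ℝ) (m n : ℤ) (j i : ℤ) : ℝ :=
  if i ≤ m then Zj X j ((1 : ℤ), (1 : ℤ)) (i, n) else Zj X j ((1 : ℤ), i - m) (m, n)

/-! ### The line-ensemble graph -/

/-- `(i,j) ∈ J₁[m,n]`. -/
def J1 (m n i j : ℤ) : Prop := 1 ≤ i ∧ i ≤ m ∧ 1 ≤ j ∧ j ≤ min i n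

/-- `(i,j) ∈ J₂[m,n]`. -/
def J2 (m n i j : ℤ) : Prop := m + 1 ≤ i ∧ i ≤ m + n ∧ 1 ≤ j ∧ j ≤ min (m + n + 1 - i) m

/-- `(i,j) ∈ J[m,n] = J₁[m,n] ∪ J₂[m,n]`. -/
def Jmem (m n i j : ℤ) : Prop := J1 m n i j ∨ J2 m n i j

/-- `(i,j) ∈ V₁[m,n]`, i.e. `(i, n+1-j) ∈ J₁[m,n]`. -/
def V1 (m n i j : ℤ) : Prop := J1 m n i (n + 1 - j)

/-- `(i,j) ∈ V₂[m,n]`, i.e. `(i, n+1-j) ∈ J₂[m,n]`. -/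
def V2 (m n i j : ℤ) : Prop := J2 m n i (n + 1 - j)

instance (m n i j : ℤ) : Decidable (J1 m n i j) := by unfold J1; infer_instance
instance (m n i j : ℤ) : Decidable (J2 m n i j) := by unfold J2; infer_instance
instance (m n i j : ℤ) : Decidable (Jmem m n i j) := by unfold Jmem; infer_instance
instance (m n i j : ℤ) : Decidable (V1 m n i j) := by unfold V1; infer_instance
instance (m n i j : ℤ) : Decidable (V2 m n i j) := by unfold V2; infer_instance

/-- Vertices of the line-ensemble graph: `Sum.inl (i,j)` is the integer vertex `(i,j)`,
and `Sum.inr j` is the auxiliary vertex `(m + ½, j)`. -/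
abbrev LVtx : Type := (ℤ × ℤ) ⊕ ℤ

/-- The edges of the line-ensemble graph: right/up edges within `V₁[m,n]`, right/down edges
within `V₂[m,n]`, and the edges `(m,j) → (m+½,j) → (m+1,j)`. -/
def LEdge (m n : ℤ) : LVtx → LVtx → Prop
  | Sum.inl p, Sum.inl q =>
      (V1 m n p.1 p.2 ∧ V1 m n q.1 q.2 ∧
        ((q.1 = p.1 + 1 ∧ q.2 = p.2) ∨ (q.1 = p.1 ∧ q.2 = p.2 + 1))) ∨
      (V2 m n p.1 p.2 ∧ V2 m n q.1 q.2 ∧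
        ((q.1 = p.1 + 1 ∧ q.2 = p.2) ∨ (q.1 = p.1 ∧ q.2 = p.2 - 1)))
  | Sum.inl p, Sum.inr j => p.1 = m ∧ p.2 = j ∧ 1 ≤ j ∧ j ≤ min m n
  | Sum.inr j, Sum.inl q => q.1 = m + 1 ∧ q.2 = j ∧ 1 ≤ j ∧ j ≤ min m n
  | Sum.inr _, Sum.inr _ => False

/-- The weights `Y[z]` on the line-ensemble graph built from an array `z`, where `z j i`
stands for `z_j(i)` (with the convention `z_j(0) = 1`). -/
noncomputable def Yw (m n : ℤ) (z : ℤ → ℤ → ℝ) : LVtx → ℝ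
  | Sum.inl p =>
      if V1 m n p.1 p.2 then
        z (n + 1 - p.2) p.1 / (if p.1 = 1 then 1 else z (n + 1 - p.2) (p.1 - 1))
      else if V2 m n p.1 p.2 then z (n + 1 - p.2) p.1 / z (n + 1 - p.2) (p.1 + 1)
      else 0
  | Sum.inr j => (z (n + 1 - j) m)⁻¹

/-- The partition function `S[z]` in the line-ensemble graph with parameters `(m,n)`. -/
noncomputable def SS (m n : ℤ) (z : ℤ → ℤ → ℝ) {k : ℕ} (u v : Fin k → LVtx) : ℝ :=
  dirPF (LEdge m n) (Yw m n z) u v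

/-- `(x,1)^↑ = (x, max (n - x + 1) 1)`. -/
def upPt (n x : ℤ) : LVtx := Sum.inl (x, max (n - x + 1) 1)

/-- `(m,b)^→ = (m + b, b)`. -/
def rightPt (m b : ℤ) : LVtx := Sum.inl (m + b, b)

/-! ### Special lists of endpoints -/

/-- The list `[(1,1),(2,1),…,(k-1,1),(a,1)]`. -/
def startList (a : ℤ) (k : ℕ) : Fin k → ℤ × ℤ :=
  fun i => if (i : ℕ) + 1 = k then (a, (1 : ℤ)) else (((i : ℕ) : ℤ) + 1, (1 : ℤ))

/-- The list `[(1,1),(2,1),…,(k,1)] = (1,1)^k`. -/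
def botList (k : ℕ) : Fin k → ℤ × ℤ :=
  fun i => (((i : ℕ) : ℤ) + 1, (1 : ℤ))

/-- The list `[(m,n),(m,n-1),…,(m,n-k+1)] = (m,n)^k`. -/
def topList (m n : ℤ) (k : ℕ) : Fin k → ℤ × ℤ :=
  fun i => (m, n - ((i : ℕ) : ℤ))

/-- The list `[(m,n),(m,n-1),…,(m,n-k+2),(m,b)]`. -/
def endList (m n b : ℤ) (k : ℕ) : Fin k → ℤ × ℤ :=
  fun i => if (i : ℕ) + 1 = k then (m, b) else (m, n - ((i : ℕ) : ℤ))

/-! ### Basic facts on up-right paths -/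

/-- The antidiagonal level of a vertex. -/
def lev (p : ℤ × ℤ) : ℤ := p.1 + p.2

/-- Strict progress along up-right paths. -/
def Prog (p q : ℤ × ℤ) : Prop := p.1 ≤ q.1 ∧ p.2 ≤ q.2 ∧ lev p < lev q

instance : IsTrans (ℤ × ℤ) Prog := ⟨by
  intro a b c h h'
  obtain ⟨h1, h2, h3⟩ := h
  obtain ⟨h4, h5, h6⟩ := h'
  exact ⟨h1.trans h4, h2.trans h5, h3.trans h6⟩⟩

lemma path_pairwise {γ : List (ℤ × ℤ)} {u v : ℤ × ℤ} (h : IsDirPath UpStep γ u v) :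
    γ.Pairwise Prog := by
  have h1 : γ.IsChain Prog := by
    refine List.IsChain.imp ?_ h.2.2
    intro a b hab
    unfold UpStep at hab
    unfold Prog lev
    omega
  exact List.isChain_iff_pairwise.mp h1

lemma path_nodup {γ : List (ℤ × ℤ)} {u v : ℤ × ℤ} (h : IsDirPath UpStep γ u v) :
    γ.Nodup := by
  refine (path_pairwise h).imp ?_
  intro a b hab e
  subst e
  exact lt_irrefl _ hab.2.2

lemma path_fun (γ : List (ℤ × ℤ)) : ∀ (u v : ℤ × ℤ), IsDirPath UpStep γ u v →
    ∃ f : ℤ → ℤ, (∀ p ∈ γ, p.2 = f (lev p) ∧ lev u ≤ lev p ∧ lev p ≤ lev v) ∧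
      (∀ s, lev u ≤ s → s ≤ lev v → (s - f s, f s) ∈ γ) ∧
      (∀ s, lev u ≤ s → s < lev v → f s ≤ f (s + 1) ∧ f (s + 1) ≤ f s + 1) ∧
      lev u ≤ lev v ∧ f (lev u) = u.2 ∧ f (lev v) = v.2 := by
  induction γ with
  | nil => intro u v h; simp [IsDirPath] at h
  | cons a l ih =>
    intro u v h
    obtain ⟨h1, h2, h3⟩ := h
    simp only [List.head?_cons, Option.some.injEq] at h1
    subst h1
    cases l with
    | nil =>
      simp only [List.getLast?_singleton, Option.some.injEq] at h2
      subst h2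
      refine ⟨fun _ => a.2, ?_, ?_, ?_, le_rfl, rfl, rfl⟩
      · intro p hp
        simp only [List.mem_singleton] at hp
        subst hp
        simp
      · intro s hs hs'
        have : s = a.1 + a.2 := le_antisymm hs' hs
        subst this
        simp
      · intro s hs hs'
        omega
    | cons b l =>
      have h3' : UpStep a b ∧ (b :: l).IsChain UpStep := by
        have h3 : (a :: b :: l).IsChain UpStep := h3
        simpa using h3
      obtain ⟨f, f1, f2, f3, f4, f5, f6⟩ := ih b v ⟨by simp, by simpa using h2, h3'.2⟩
      have hab := h3'.1
      have hl : lev b = lev a + 1 := by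
        unfold UpStep at hab; unfold lev; omega
      have hb2 : a.2 ≤ b.2 ∧ b.2 ≤ a.2 + 1 := by
        unfold UpStep at hab; omega
      refine ⟨fun s => if s ≤ lev a then a.2 else f s, ?_, ?_, ?_, by omega, by simp, ?_⟩
      · intro p hp
        rcases List.mem_cons.mp hp with rfl | hp
        · simp; omega
        · obtain ⟨e1, e2, e3⟩ := f1 p hp
          have : ¬ lev p ≤ lev a := by omega
          simp only [this, if_false]
          exact ⟨e1, by omega, e3⟩
      · intro s hs hs'
        by_cases hsa : s ≤ lev a
        · have : s = lev a := le_antisymm hsa hs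
          subst this
          have e : (lev a - a.2, a.2) = a := by ext <;> simp [lev]
          simp [e]
        · simp only [hsa, if_false]
          exact List.mem_cons_of_mem _ (f2 s (by omega) hs')
      · intro s hs hs'
        by_cases hsa : s ≤ lev a
        · have e : s = lev a := le_antisymm hsa hs
          have : ¬ s + 1 ≤ lev a := by omega
          simp only [hsa, this, if_true, if_false]
          rw [e, ← hl, f5]
          exact hb2
        · have : ¬ s + 1 ≤ lev a := by omega
          simp only [hsa, this, if_false]
          exact f3 s (by omega) hs'
      · have : ¬ lev v ≤ lev a := by omega
        simp only [this, if_false]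
        exact f6

/-- monotonicity from the steps -/
lemma step_mono {f : ℤ → ℤ} {a b : ℤ}
    (h : ∀ s, a ≤ s → s < b → f s ≤ f (s + 1) ∧ f (s + 1) ≤ f s + 1) :
    ∀ s t, a ≤ s → s ≤ t → t ≤ b → f s ≤ f t ∧ f t ≤ f s + (t - s) := by
  intro s t hs hst
  induction t, hst using Int.le_induction with
  | base => intro _; simp
  | succ n hn ih =>
    intro hb
    have := h n (by omega) (by omega)
    have := ih (by omega)
    omega

/-- discrete intermediate value property -/
lemma sign_const {f g : ℤ → ℤ} {a b : ℤ}
    (hf : ∀ s, a ≤ s → s < b → f s ≤ f (s + 1) ∧ f (s + 1) ≤ f s + 1)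
    (hg : ∀ s, a ≤ s → s < b → g s ≤ g (s + 1) ∧ g (s + 1) ≤ g s + 1)
    (hne : ∀ s, a ≤ s → s ≤ b → f s ≠ g s) {s₀ : ℤ} (h1 : a ≤ s₀) (h2 : s₀ ≤ b)
    (h0 : g s₀ < f s₀) : ∀ s, a ≤ s → s ≤ b → g s < f s := by
  intro s hs hs'
  rcases le_total s₀ s with h | h
  · revert hs hs'
    induction s, h using Int.le_induction with
    | base => intros; exact h0
    | succ n hn ih =>
      intro _ _
      have := hf n (by omega) (by omega)
      have := hg n (by omega) (by omega)
      have := hne (n + 1) (by omega) (by omega)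
      have := ih (by omega) (by omega)
      omega
  · revert hs hs'
    induction s, h using Int.le_induction_down with
    | base => intros; exact h0
    | pred n hn ih =>
      intro _ _
      have h3 := hf (n - 1) (by omega) (by omega)
      have h4 := hg (n - 1) (by omega) (by omega)
      rw [sub_add_cancel] at h3 h4
      have := hne (n - 1) (by omega) (by omega)
      have := ih (by omega) (by omega)
      omega

/-- Right-then-up path. -/
lemma exists_vert (n : ℕ) : ∀ (p q : ℤ × ℤ), q.1 = p.1 → q.2 = p.2 + n →
    ∃ γ, IsDirPath UpStep γ p q ∧ ∀ w ∈ γ, w.1 = q.1 ∧ w.2 ≤ q.2 := by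
  induction n with
  | zero =>
    intro p q h1 h2
    have : q = p := Prod.ext h1 (by simpa using h2)
    subst this
    exact ⟨[q], ⟨by simp, by simp, List.isChain_singleton q⟩, by simp⟩
  | succ n ih =>
    intro p q h1 h2
    push_cast at h2
    obtain ⟨γ, ⟨g1, g2, g3⟩, h⟩ := ih (p.1, p.2 + 1) q h1 (by simp; omega)
    refine ⟨p :: γ, ⟨by simp, ?_, ?_⟩, ?_⟩
    · rw [List.getLast?_cons, g2]; rfl
    · refine List.isChain_cons.mpr ⟨?_, g3⟩
      intro y hy
      rw [g1] at hy
      simp only [Option.mem_def, Option.some.injEq] at hy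
      subst hy
      right; simp
    · intro w hw
      rcases List.mem_cons.mp hw with rfl | hw
      · omega
      · exact h w hw

lemma exists_right_up (n : ℕ) : ∀ (p q : ℤ × ℤ), q.1 = p.1 + n → p.2 ≤ q.2 →
    ∃ γ, IsDirPath UpStep γ p q ∧
      ∀ w ∈ γ, (w.2 = p.2 ∧ p.1 ≤ w.1) ∨ (w.1 = q.1 ∧ w.2 ≤ q.2) := by
  induction n with
  | zero =>
    intro p q h1 h2
    obtain ⟨γ, h, h'⟩ := exists_vert (q.2 - p.2).toNat p q (by simpa using h1) (by omega)
    exact ⟨γ, h, fun w hw => Or.inr (h' w hw)⟩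
  | succ n ih =>
    intro p q h1 h2
    push_cast at h1
    obtain ⟨γ, ⟨g1, g2, g3⟩, h⟩ := ih (p.1 + 1, p.2) q (by simp; omega) h2
    refine ⟨p :: γ, ⟨by simp, ?_, ?_⟩, ?_⟩
    · rw [List.getLast?_cons, g2]; rfl
    · refine List.isChain_cons.mpr ⟨?_, g3⟩
      intro y hy
      rw [g1] at hy
      simp only [Option.mem_def, Option.some.injEq] at hy
      subst hy
      left; simp
    · intro w hw
      rcases List.mem_cons.mp hw with rfl | hw
      · left; simp
      · have := h w hw
        simp only at this
        omega

/-- Under the crossing hypothesis, a disjoint system only exists for the identity. -/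
lemma perm_eq_one {k : ℕ} (u v : Fin k → ℤ × ℤ)
    (hord : ∀ i j : Fin k, (u i).1 ≤ (v j).1 ∧ (u i).2 ≤ (v j).2)
    (hcross : ∀ i j : Fin k, i ≠ j → ∀ γ γ' : List (ℤ × ℤ),
      IsDirPath UpStep γ (u i) (v j) → IsDirPath UpStep γ' (u j) (v i) →
      ∃ w, w ∈ γ ∧ w ∈ γ')
    (σ : Equiv.Perm (Fin k)) (γ : Fin k → List (ℤ × ℤ))
    (hγ : ∀ a, IsDirPath UpStep (γ a) (u a) (v (σ a)))
    (hdis : ∀ i j, i ≠ j → ∀ w ∈ γ i, w ∉ γ j) : σ = 1 := by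
  by_contra hσ
  have hl : ∀ i j, lev (u i) ≤ lev (v j) := by
    intro i j
    have := hord i j
    unfold lev; omega
  choose f f1 f2 f3 f4 f5 f6 using fun a => path_fun (γ a) _ _ (hγ a)
  have hmoved : σ.support.Nonempty := by
    rw [Finset.nonempty_iff_ne_empty]
    simpa using hσ
  obtain ⟨i₀, hi₀⟩ := hmoved
  -- a common level
  obtain ⟨m, -, hm⟩ := Finset.exists_max_image Finset.univ (fun a => lev (u a)) ⟨i₀, by simp⟩
  have hm' : ∀ a, lev (u a) ≤ lev (u m) := fun a => hm a (by simp)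
  obtain ⟨i, hi, hmax⟩ := Finset.exists_max_image σ.support (fun a => f a (lev (u m))) ⟨i₀, hi₀⟩
  have hne : ∀ a b, a ≠ b → ∀ s, lev (u a) ≤ s → lev (u b) ≤ s → s ≤ lev (v (σ a)) →
      s ≤ lev (v (σ b)) → f a s ≠ f b s := by
    intro a b hab s h1 h2 h3 h4 e
    have e1 := f2 a s h1 h3
    have e2 := f2 b s h2 h4
    rw [e] at e1
    exact hdis a b hab _ e1 e2
  have key : ∀ b ∈ σ.support, b ≠ i → ∀ s, lev (u i) ≤ s → lev (u b) ≤ s →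
      s ≤ lev (v (σ i)) → s ≤ lev (v (σ b)) → f b s < f i s := by
    intro b hb hbi s h1 h2 h3 h4
    have hlt : f b (lev (u m)) < f i (lev (u m)) :=
      lt_of_le_of_ne (hmax b hb) (hne b i hbi _ (hm' b) (hm' i) (hl _ _) (hl _ _))
    refine sign_const (a := max (lev (u i)) (lev (u b)))
      (b := min (lev (v (σ i))) (lev (v (σ b)))) (s₀ := lev (u m)) ?_ ?_ ?_ ?_ ?_ hlt s ?_ ?_
    · intro s hs hs'
      exact f3 i s (by omega) (by omega)
    · intro s hs hs'
      exact f3 b s (by omega) (by omega)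
    · intro s hs hs'
      exact hne i b hbi.symm s (by omega) (by omega) (by omega) (by omega)
    · exact max_le (hm' i) (hm' b)
    · exact le_min (hl _ _) (hl _ _)
    · omega
    · omega
  have hji : σ i ≠ i := Equiv.Perm.mem_support.mp hi
  have hjs : σ i ∈ σ.support := Equiv.Perm.apply_mem_support.mpr hi
  have hni : σ⁻¹ i ≠ i := by
    intro h
    apply hji
    conv_lhs => rw [← h]
    simp
  have hns : σ⁻¹ i ∈ σ.support := by
    rw [← Equiv.Perm.apply_mem_support]; simpa using hi
  have hσn : σ (σ⁻¹ i) = i := by simp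
  have h0 := hord (σ i) i
  obtain ⟨R, hR, hR'⟩ := exists_right_up ((v i).1 - (u (σ i)).1).toNat (u (σ i)) (v i)
    (by omega) h0.2
  obtain ⟨w, hw, hwR⟩ := hcross i (σ i) hji.symm (γ i) R (hγ i) hR
  obtain ⟨w1, w2, w3⟩ := f1 i w hw
  rcases hR' w hwR with ⟨e1, e2⟩ | ⟨e1, e2⟩
  · have hws : lev (u (σ i)) ≤ lev w := by unfold lev; omega
    have q := hl i (σ (σ i))
    have q' := hl (σ i) (σ (σ i))
    have q'' := hl (σ i) (σ i)
    have k1 := key (σ i) hjs hji (max (lev (u i)) (lev (u (σ i)))) (by omega) (by omega)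
      (by omega) (by omega)
    have k2 := (step_mono (f3 (σ i)) (lev (u (σ i))) (max (lev (u i)) (lev (u (σ i))))
      (by omega) (by omega) (by omega)).1
    rw [f5] at k2
    have k3 := (step_mono (f3 i) (max (lev (u i)) (lev (u (σ i)))) (lev w)
      (by omega) (by omega) (by omega)).1
    omega
  · have hws : lev w ≤ lev (v i) := by unfold lev; omega
    have q := hl i i
    have q' := hl (σ⁻¹ i) (σ i)
    have q'' := hl (σ⁻¹ i) i
    have k1 := key (σ⁻¹ i) hns hni (min (lev (v (σ i))) (lev (v i))) (by omega) (by omega)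
      (by omega) (by rw [hσn]; omega)
    have k2 := (step_mono (f3 (σ⁻¹ i)) (min (lev (v (σ i))) (lev (v i))) (lev (v (σ (σ⁻¹ i))))
      (by omega) (by rw [hσn]; omega) (by omega)).2
    rw [f6, hσn] at k2
    have k3 := (step_mono (f3 i) (lev w) (min (lev (v (σ i))) (lev (v i)))
      (by omega) (by omega) (by omega)).2
    have l1 : lev w = w.1 + w.2 := rfl
    have l2 : lev (v i) = (v i).1 + (v i).2 := rfl
    omega

/-! ### Finiteness and partition functions as finite sums -/

lemma paths_finite (u v : ℤ × ℤ) : {γ | IsDirPath UpStep γ u v}.Finite := by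
  refine Set.Finite.of_finite_image (f := fun γ : List (ℤ × ℤ) => γ.toFinset) ?_ ?_
  · refine Set.Finite.subset (((Finset.Icc (lev u) (lev v) ×ˢ Finset.Icc u.2 v.2).image
      (fun p : ℤ × ℤ => (p.1 - p.2, p.2))).powerset.finite_toSet) ?_
    rintro _ ⟨γ, hγ, rfl⟩
    simp only [Finset.coe_powerset, Set.mem_preimage, Set.mem_powerset_iff]
    intro w hw
    have hw : w ∈ γ := by simpa using hw
    obtain ⟨f, f1, f2, f3, f4, f5, f6⟩ := path_fun γ u v hγ
    obtain ⟨e1, e2, e3⟩ := f1 w hw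
    have k1 := (step_mono f3 (lev u) (lev w) le_rfl e2 e3).1
    have k2 := (step_mono f3 (lev w) (lev v) e2 e3 le_rfl).1
    simp only [Finset.coe_image, Set.mem_image, Finset.mem_coe, Finset.mem_product,
      Finset.mem_Icc]
    refine ⟨(lev w, w.2), ⟨⟨e2, e3⟩, by simp only; omega, by simp only; omega⟩, ?_⟩
    ext <;> simp [lev]
  · intro γ hγ γ' hγ' h
    have hp : γ.Perm γ' := by
      rw [List.perm_ext_iff_of_nodup (path_nodup hγ) (path_nodup hγ')]
      intro a
      have : a ∈ γ.toFinset ↔ a ∈ γ'.toFinset := by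
        simp only at h
        rw [h]
      simpa using this
    refine hp.eq_of_pairwise ?_ (path_pairwise hγ) (path_pairwise hγ')
    intro a b _ _ h1 h2
    exact absurd (h1.2.2.trans h2.2.2) (lt_irrefl _)

/-- The finite set of up-right paths. -/
noncomputable def paths (u v : ℤ × ℤ) : Finset (List (ℤ × ℤ)) := (paths_finite u v).toFinset

lemma mem_paths {u v : ℤ × ℤ} {γ : List (ℤ × ℤ)} :
    γ ∈ paths u v ↔ IsDirPath UpStep γ u v := by simp [paths]

/-- Product of the weights along a path. -/
noncomputable def wt (X : ℤ × ℤ → ℝ) (γ : List (ℤ × ℤ)) : ℝ := (γ.map X).prod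

/-- vertex disjointness -/
def Disj {k : ℕ} (γ : Fin k → List (ℤ × ℤ)) : Prop := ∀ i j, i ≠ j → ∀ w ∈ γ i, w ∉ γ j

open Classical in
lemma TT_eq (X : ℤ × ℤ → ℝ) {k : ℕ} (u v : Fin k → ℤ × ℤ) :
    TT X u v = ∑ γ ∈ (Fintype.piFinset fun a => paths (u a) (v a)) with Disj γ,
      ∏ a, wt X (γ a) := by
  have hset : DisjointPathTuples UpStep u v =
      ↑((Fintype.piFinset fun a => paths (u a) (v a)).filter Disj) := by
    ext γ
    simp [DisjointPathTuples, mem_paths, Disj]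
  unfold TT dirPF
  rw [hset, Finset.tsum_subtype' _ (tupleWeight X)]
  refine Finset.sum_congr rfl ?_
  intro γ hγ
  simp only [Finset.mem_filter, Fintype.mem_piFinset, mem_paths] at hγ
  unfold tupleWeight
  rw [Finset.prod_biUnion]
  · refine Finset.prod_congr rfl ?_
    intro a _
    rw [wt, List.prod_toFinset _ (path_nodup (hγ.1 a))]
  · intro a _ b _ hab
    rw [Function.onFun, Finset.disjoint_left]
    intro w hw hw'
    exact hγ.2 a b hab w (by simpa using hw) (by simpa using hw')

lemma T1_eq (X : ℤ × ℤ → ℝ) (u v : ℤ × ℤ) : T1 X u v = ∑ γ ∈ paths u v, wt X γ := by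
  classical
  unfold T1
  rw [TT_eq, Finset.filter_true_of_mem]
  · rw [← Finset.prod_univ_sum (fun _ : Fin 1 => paths u v) (fun _ γ => wt X γ)]
    simp
  · intro γ _ i j hij
    exact absurd (Subsingleton.elim i j) hij

/-! ### Tail swapping -/

/-- Initial part of a path. -/
def lo (t : ℤ) (γ : List (ℤ × ℤ)) : List (ℤ × ℤ) := γ.filter (fun p => decide (lev p ≤ t))

/-- Final part of a path. -/
def hi (t : ℤ) (γ : List (ℤ × ℤ)) : List (ℤ × ℤ) := γ.filter (fun p => decide (t < lev p))

lemma lo_append_hi (t : ℤ) {γ : List (ℤ × ℤ)} (h : γ.Pairwise Prog) : lo t γ ++ hi t γ = γ := by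
  induction γ with
  | nil => rfl
  | cons a l ih =>
    rw [List.pairwise_cons] at h
    have ih := ih h.2
    by_cases ha : lev a ≤ t
    · have : ¬ t < lev a := not_lt.mpr ha
      simp only [lo, hi, List.filter_cons, ha, this, decide_true, decide_false, if_true] at ih ⊢
      simpa using ih
    · have ha' : t < lev a := not_le.mp ha
      have : lo t l = [] := by
        simp only [lo, List.filter_eq_nil_iff, decide_eq_true_eq, not_le]
        intro b hb
        exact ha'.trans (h.1 b hb).2.2
      rw [this] at ih
      simp only [List.nil_append] at ih
      have e : lo t (a :: l) = [] := by
        rw [← this]; simp [lo, List.filter_cons, ha]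
      have e' : hi t (a :: l) = a :: hi t l := by simp [hi, List.filter_cons, ha']
      rw [e, e', ih]; rfl

lemma split_at {γ : List (ℤ × ℤ)} (h : γ.Pairwise Prog) {w : ℤ × ℤ} (hw : w ∈ γ) :
    ∃ a b, γ = a ++ w :: b ∧ lo (lev w) γ = a ++ [w] ∧ hi (lev w) γ = b := by
  obtain ⟨a, b, rfl⟩ := List.append_of_mem hw
  refine ⟨a, b, rfl, ?_⟩
  rw [List.pairwise_append, List.pairwise_cons] at h
  obtain ⟨h1, ⟨h2, h3⟩, h4⟩ := h
  have a1 : ∀ x ∈ a, lev x < lev w := fun x hx => (h4 x hx w (by simp)).2.2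
  have b1 : ∀ x ∈ b, lev w < lev x := fun x hx => (h2 x hx).2.2
  have e1 : a.filter (fun p => decide (lev p ≤ lev w)) = a :=
    List.filter_eq_self.mpr fun x hx => by simpa using (a1 x hx).le
  have e2 : b.filter (fun p => decide (lev p ≤ lev w)) = [] :=
    List.filter_eq_nil_iff.mpr fun x hx => by simpa using b1 x hx
  have e3 : a.filter (fun p => decide (lev w < lev p)) = [] :=
    List.filter_eq_nil_iff.mpr fun x hx => by simpa using (a1 x hx).le
  have e4 : b.filter (fun p => decide (lev w < lev p)) = b :=
    List.filter_eq_self.mpr fun x hx => by simpa using b1 x hx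
  simp [lo, hi, List.filter_append, List.filter_cons, e1, e2, e3, e4]

lemma swap_path {γ γ' : List (ℤ × ℤ)} {u v u' v' w : ℤ × ℤ} (h : IsDirPath UpStep γ u v)
    (h' : IsDirPath UpStep γ' u' v') (hw : w ∈ γ) (hw' : w ∈ γ') :
    IsDirPath UpStep (lo (lev w) γ ++ hi (lev w) γ') u v' := by
  obtain ⟨a, b, rfl, e1, -⟩ := split_at (path_pairwise h) hw
  obtain ⟨a', b', rfl, -, e2⟩ := split_at (path_pairwise h') hw'
  rw [e1, e2]
  obtain ⟨h1, h2, h3⟩ := h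
  obtain ⟨h1', h2', h3'⟩ := h'
  replace h3 : (a ++ w :: b).IsChain UpStep := h3
  have c1 : (a ++ [w]).IsChain UpStep := by
    refine List.IsChain.left_of_append (l₂ := b) ?_
    simpa using h3
  have c2 : (w :: b').IsChain UpStep := List.IsChain.right_of_append h3'
  refine ⟨?_, ?_, ?_⟩
  · rw [← h1]; cases a <;> simp
  · rw [← h2']; simp [List.getLast?_cons]
  · have : (a ++ w :: b').IsChain UpStep := List.isChain_split.mpr ⟨c1, c2⟩
    change ((a ++ [w]) ++ b').IsChain UpStep
    simpa using this

/-- Vertices on at least two paths. -/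
def Multi {k : ℕ} (γ : Fin k → List (ℤ × ℤ)) : Set (ℤ × ℤ) :=
  {w | ∃ a b, a ≠ b ∧ w ∈ γ a ∧ w ∈ γ b}

/-- A chosen vertex on two paths. -/
noncomputable def cw {k : ℕ} (γ : Fin k → List (ℤ × ℤ)) : ℤ × ℤ :=
  Classical.epsilon (fun w => w ∈ Multi γ)

/-- A chosen transposition of two indices in a set. -/
noncomputable def csw {k : ℕ} (S : Set (Fin k)) : Equiv.Perm (Fin k) :=
  Classical.epsilon (fun τ => ∃ a b, a ≠ b ∧ a ∈ S ∧ b ∈ S ∧ τ = Equiv.swap a b)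

/-- The chosen transposition of a tuple of paths. -/
noncomputable def ct {k : ℕ} (γ : Fin k → List (ℤ × ℤ)) : Equiv.Perm (Fin k) :=
  csw {a | cw γ ∈ γ a}

/-- Swap the tails. -/
noncomputable def tailSwap {k : ℕ} (γ : Fin k → List (ℤ × ℤ)) : Fin k → List (ℤ × ℤ) :=
  fun a => lo (lev (cw γ)) (γ a) ++ hi (lev (cw γ)) (γ (ct γ a))

lemma multi_of_not_disj {k : ℕ} {γ : Fin k → List (ℤ × ℤ)} :
    ¬ Disj γ ↔ (Multi γ).Nonempty := by
  unfold Disj Multi Set.Nonempty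
  push Not
  constructor
  · rintro ⟨i, j, h, w, h1, h2⟩
    exact ⟨w, i, j, h, h1, h2⟩
  · rintro ⟨w, i, j, h, h1, h2⟩
    exact ⟨i, j, h, w, h1, h2⟩

lemma ct_spec {k : ℕ} {γ : Fin k → List (ℤ × ℤ)} (h : ¬ Disj γ) :
    ∃ a b, a ≠ b ∧ cw γ ∈ γ a ∧ cw γ ∈ γ b ∧ ct γ = Equiv.swap a b := by
  have h1 : cw γ ∈ Multi γ := Classical.epsilon_spec (multi_of_not_disj.mp h)
  obtain ⟨a, b, hab, ha, hb⟩ := h1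
  exact Classical.epsilon_spec (p := fun τ => ∃ a b, a ≠ b ∧ a ∈ {a | cw γ ∈ γ a} ∧
    b ∈ {a | cw γ ∈ γ a} ∧ τ = Equiv.swap a b) ⟨_, a, b, hab, ha, hb, rfl⟩

lemma mem_tailSwap {k : ℕ} {γ : Fin k → List (ℤ × ℤ)} {a : Fin k} {p : ℤ × ℤ} :
    p ∈ tailSwap γ a ↔ if lev p ≤ lev (cw γ) then p ∈ γ a else p ∈ γ (ct γ a) := by
  unfold tailSwap lo hi
  split_ifs with h
  · simp [h]
  · simp [h, not_le.mp h]

lemma multi_tailSwap {k : ℕ} (γ : Fin k → List (ℤ × ℤ)) : Multi (tailSwap γ) = Multi γ := by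
  ext p
  simp only [Multi, Set.mem_setOf_eq, mem_tailSwap]
  split_ifs with h
  · rfl
  · constructor
    · rintro ⟨a, b, hab, ha, hb⟩
      exact ⟨_, _, fun e => hab ((ct γ).injective e), ha, hb⟩
    · rintro ⟨a, b, hab, ha, hb⟩
      exact ⟨(ct γ).symm a, (ct γ).symm b, fun e => hab ((ct γ).symm.injective e),
        by simpa using ha, by simpa using hb⟩

lemma cw_tailSwap {k : ℕ} (γ : Fin k → List (ℤ × ℤ)) : cw (tailSwap γ) = cw γ := by
  unfold cw; rw [multi_tailSwap]

lemma ct_tailSwap {k : ℕ} (γ : Fin k → List (ℤ × ℤ)) : ct (tailSwap γ) = ct γ := by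
  unfold ct
  rw [cw_tailSwap]
  congr 1
  ext a
  simp [mem_tailSwap]

lemma not_disj_tailSwap {k : ℕ} {γ : Fin k → List (ℤ × ℤ)} (h : ¬ Disj γ) :
    ¬ Disj (tailSwap γ) := by
  rw [multi_of_not_disj] at h ⊢
  rwa [multi_tailSwap]

lemma lo_app (t : ℤ) (l l' : List (ℤ × ℤ)) : lo t (lo t l ++ hi t l') = lo t l := by
  have : (l'.filter (fun p => decide (t < lev p))).filter (fun p => decide (lev p ≤ t)) = [] := by
    simp
  simp only [lo, hi, List.filter_append, this]
  simp

lemma hi_app (t : ℤ) (l l' : List (ℤ × ℤ)) : hi t (lo t l ++ hi t l') = hi t l' := by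
  have : (l.filter (fun p => decide (lev p ≤ t))).filter (fun p => decide (t < lev p)) = [] := by
    simp
  simp only [lo, hi, List.filter_append, this]
  simp

lemma tailSwap_tailSwap {k : ℕ} {γ : Fin k → List (ℤ × ℤ)} (hp : ∀ a, (γ a).Pairwise Prog)
    (h : ¬ Disj γ) : tailSwap (tailSwap γ) = γ := by
  funext a
  have e : tailSwap (tailSwap γ) a =
      lo (lev (cw γ)) (tailSwap γ a) ++ hi (lev (cw γ)) (tailSwap γ (ct γ a)) := by
    conv_lhs => rw [tailSwap, cw_tailSwap, ct_tailSwap]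
  rw [e]
  simp only [tailSwap]
  rw [lo_app, hi_app]
  obtain ⟨i, j, -, -, -, hs⟩ := ct_spec h
  rw [hs, Equiv.swap_apply_self, lo_append_hi _ (hp a)]

lemma tailSwap_path {k : ℕ} {γ : Fin k → List (ℤ × ℤ)} {u v : Fin k → ℤ × ℤ}
    {σ : Equiv.Perm (Fin k)} (hp : ∀ a, IsDirPath UpStep (γ a) (u a) (v (σ a)))
    (h : ¬ Disj γ) (a : Fin k) :
    IsDirPath UpStep (tailSwap γ a) (u a) (v ((σ * ct γ) a)) := by
  obtain ⟨i, j, hij, hi', hj', hs⟩ := ct_spec h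
  rw [Equiv.Perm.mul_apply]
  unfold tailSwap
  by_cases hfix : ct γ a = a
  · rw [hfix, lo_append_hi _ (path_pairwise (hp a))]
    exact hp a
  · refine swap_path (hp a) (hp _) ?_ ?_
    · rw [hs] at hfix
      by_cases e : a = i
      · rw [e]; exact hi'
      · by_cases e' : a = j
        · rw [e']; exact hj'
        · exact absurd (Equiv.swap_apply_of_ne_of_ne e e') hfix
    · rw [hs] at hfix ⊢
      by_cases e : a = i
      · rw [e, Equiv.swap_apply_left]; exact hj'
      · by_cases e' : a = j
        · rw [e', Equiv.swap_apply_right]; exact hi'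
        · exact absurd (Equiv.swap_apply_of_ne_of_ne e e') hfix

lemma wt_tailSwap (X : ℤ × ℤ → ℝ) {k : ℕ} {γ : Fin k → List (ℤ × ℤ)}
    (hp : ∀ a, (γ a).Pairwise Prog) : ∏ a, wt X (tailSwap γ a) = ∏ a, wt X (γ a) := by
  have e1 : ∀ a, wt X (tailSwap γ a) =
      wt X (lo (lev (cw γ)) (γ a)) * wt X (hi (lev (cw γ)) (γ (ct γ a))) := by
    intro a; simp [tailSwap, wt]
  have e2 : ∀ a, wt X (γ a) =
      wt X (lo (lev (cw γ)) (γ a)) * wt X (hi (lev (cw γ)) (γ a)) := by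
    intro a
    conv_lhs => rw [← lo_append_hi (lev (cw γ)) (hp a)]
    simp [wt]
  simp only [e1, Finset.prod_mul_distrib]
  rw [Equiv.prod_comp (ct γ) (fun a => wt X (hi (lev (cw γ)) (γ a))),
    ← Finset.prod_mul_distrib]
  exact Finset.prod_congr rfl fun a _ => (e2 a).symm

/-- **Lindström–Gessel–Viennot.** If `u i ≤ v j` coordinatewise for all `i,j`, and for all
`i ≠ j` every up-right path from `u i` to `v j` shares a vertex with every up-right path from
`u j` to `v i`, then the `k`-path disjoint partition function equals the determinant of the
matrix of one-path partition functions. -/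
theorem disjoint_pf_eq_det (X : ℤ × ℤ → ℝ) (k : ℕ) (u v : Fin k → ℤ × ℤ)
    (hord : ∀ i j : Fin k, (u i).1 ≤ (v j).1 ∧ (u i).2 ≤ (v j).2)
    (hcross : ∀ i j : Fin k, i ≠ j → ∀ γ γ' : List (ℤ × ℤ),
      IsDirPath UpStep γ (u i) (v j) → IsDirPath UpStep γ' (u j) (v i) →
      ∃ w, w ∈ γ ∧ w ∈ γ') :
    TT X u v = Matrix.det (Matrix.of fun i j => T1 X (u i) (v j)) := by
  classical
  have hdet : Matrix.det (Matrix.of fun i j => T1 X (u i) (v j)) =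
      ∑ σ : Equiv.Perm (Fin k), ∑ γ ∈ Fintype.piFinset fun a => paths (u a) (v (σ a)),
        ((Equiv.Perm.sign σ : ℤ) : ℝ) * ∏ a, wt X (γ a) := by
    rw [← Matrix.det_transpose, Matrix.det_apply']
    refine Finset.sum_congr rfl fun σ _ => ?_
    rw [← Finset.mul_sum, ← Finset.prod_univ_sum (fun a => paths (u a) (v (σ a)))
      (fun _ γ => wt X γ)]
    simp [T1_eq]
  rw [hdet, Finset.sum_sigma', ← Finset.sum_filter_add_sum_filter_not _ (fun x => Disj x.2)]
  have hbad : ∑ x ∈ (Finset.univ.sigma fun σ : Equiv.Perm (Fin k) =>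
      Fintype.piFinset fun a => paths (u a) (v (σ a))) with ¬ Disj x.2,
      ((Equiv.Perm.sign x.1 : ℤ) : ℝ) * ∏ a, wt X (x.2 a) = 0 := by
    refine Finset.sum_involution (fun x _ => ⟨x.1 * ct x.2, tailSwap x.2⟩) ?_ ?_ ?_ ?_
    · rintro ⟨σ, γ⟩ hx
      simp only [Finset.mem_filter, Finset.mem_sigma, Finset.mem_univ, true_and,
        Fintype.mem_piFinset, mem_paths] at hx
      obtain ⟨i, j, hij, -, -, hs⟩ := ct_spec hx.2
      simp only
      rw [wt_tailSwap X (fun a => path_pairwise (hx.1 a)), hs, Equiv.Perm.sign_mul,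
        Equiv.Perm.sign_swap hij]
      simp
    · rintro ⟨σ, γ⟩ hx _ he
      simp only [Finset.mem_filter] at hx
      obtain ⟨i, j, hij, -, -, hs⟩ := ct_spec hx.2
      have h1 : σ * ct γ = σ := congrArg Sigma.fst he
      rw [hs, mul_eq_left, Equiv.swap_eq_one_iff] at h1
      exact hij h1
    · rintro ⟨σ, γ⟩ hx
      simp only [Finset.mem_filter, Finset.mem_sigma, Finset.mem_univ, true_and,
        Fintype.mem_piFinset, mem_paths] at hx ⊢
      exact ⟨tailSwap_path hx.1 hx.2, not_disj_tailSwap hx.2⟩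
    · rintro ⟨σ, γ⟩ hx
      simp only [Finset.mem_filter, Finset.mem_sigma, Finset.mem_univ, true_and,
        Fintype.mem_piFinset, mem_paths] at hx
      obtain ⟨i, j, hij, -, -, hs⟩ := ct_spec hx.2
      simp only
      rw [tailSwap_tailSwap (fun a => path_pairwise (hx.1 a)) hx.2, ct_tailSwap, hs, mul_assoc,
        Equiv.swap_mul_self, mul_one]
  rw [hbad, add_zero, TT_eq]
  refine Finset.sum_bij (fun γ _ => ⟨1, γ⟩) ?_ ?_ ?_ ?_
  · intro γ hγ
    simpa using hγ
  · intro γ _ γ' _ h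
    simpa using h
  · rintro ⟨σ, γ⟩ hx
    simp only [Finset.mem_filter, Finset.mem_sigma, Finset.mem_univ, true_and,
      Fintype.mem_piFinset, mem_paths] at hx
    have := perm_eq_one u v hord hcross σ γ hx.1 hx.2
    subst this
    refine ⟨γ, ?_, rfl⟩
    simp only [Finset.mem_filter, Fintype.mem_piFinset, mem_paths]
    exact hx
  · intro γ _
    simp
end

section
/- Let X : ℤ² → (0,∞) be strictly positive vertex weights, m,n ≥ 1, and 1 ≤ a ≤ m, 1 ≤ b ≤ n integers. Then T₁((a,1),(m,b)) = Σ_{k=1}^{min(a, n−b+1)} T([(1,1)^{k−1},(a,1)],[(m,n)^k]) · T([(1,1)^k],[(m,n)^{k−1},(m,b)]) / ( T_k((1,1),(m,n)) · T_{k−1}((1,1),(m,n)) ), where [(1,1)^{k−1},(a,1)] denotes the list (1,1),(2,1),…,(k−1,1),(a,1) and [(m,n)^{k−1},(m,b)] the list (m,n),(m,n−1),…,(m,n−k+2),(m,b). -/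
open scoped BigOperators

set_option linter.deprecated false

namespace CrossDec

abbrev UP (γ : List (ℤ × ℤ)) (u v : ℤ × ℤ) : Prop := IsDirPath UpStep γ u v

lemma up_ne_nil {γ : List (ℤ × ℤ)} {u v : ℤ × ℤ} (h : UP γ u v) : γ ≠ [] := by
  rintro rfl
  simp [UP, IsDirPath] at h

lemma up_singleton {w u v : ℤ × ℤ} : UP [w] u v ↔ w = u ∧ w = v := by
  simp [UP, IsDirPath, List.Chain']

lemma up_cons_cons {w x u v : ℤ × ℤ} {l : List (ℤ × ℤ)} :
    UP (w :: x :: l) u v ↔ w = u ∧ UpStep u x ∧ UP (x :: l) x v := by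
  simp only [UP, IsDirPath, List.Chain', List.head?_cons, Option.some.injEq,
    List.getLast?_cons_cons, List.isChain_cons_cons]
  constructor
  · rintro ⟨rfl, h, h1, h2⟩
    exact ⟨rfl, h1, trivial, h, h2⟩
  · rintro ⟨rfl, h1, -, h, h2⟩
    exact ⟨rfl, h, h1, h2⟩

lemma up_split {A B : List (ℤ × ℤ)} {w u v : ℤ × ℤ} :
    UP (A ++ w :: B) u v ↔ UP (A ++ [w]) u w ∧ UP (w :: B) w v := by
  simp only [UP, IsDirPath, List.Chain']
  rw [List.isChain_split]
  have h1 : (A ++ w :: B).head? = (A ++ [w]).head? := by cases A <;> simp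
  have h2 : (A ++ w :: B).getLast? = (w :: B).getLast? := by
    rw [List.getLast?_append_of_ne_nil]; simp
  rw [h1, h2]
  simp only [List.head?_cons, List.getLast?_append, List.getLast?_singleton]
  simp
  tauto

/-- appending a last vertex -/
lemma up_snoc {A : List (ℤ × ℤ)} {w u v : ℤ × ℤ} (h : UpStep w v) (hA : UP A u w) :
    UP (A ++ [v]) u v := by
  obtain ⟨h1, h2, h3⟩ := hA
  refine ⟨?_, by simp, ?_⟩
  · cases A <;> simp_all
  · unfold List.Chain' at *
    rw [List.isChain_append]
    refine ⟨h3, by simp, ?_⟩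
    simp [h2]
    exact h

lemma up_snoc_inv {γ : List (ℤ × ℤ)} {u v : ℤ × ℤ} (h : UP γ u v) (huv : u ≠ v) :
    ∃ A w, γ = A ++ [v] ∧ UpStep w v ∧ UP A u w := by
  obtain ⟨h1, h2, h3⟩ := h
  rcases List.eq_nil_or_concat γ with rfl | ⟨A, x, rfl⟩
  · simp at h1
  · simp at h2
    subst h2
    rcases List.eq_nil_or_concat A with rfl | ⟨B, w, rfl⟩
    · simp at h1
      exact absurd h1.symm huv
    · refine ⟨B ++ [w], w, by simp, ?_, ?_, by simp, ?_⟩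
      · unfold List.Chain' at h3
        rw [List.concat_eq_append, List.isChain_append] at h3
        simpa using h3.2.2
      · cases B <;> simp_all
      · unfold List.Chain' at *
        rw [List.concat_eq_append, List.isChain_append] at h3
        simpa using h3.1

lemma up_mem {γ : List (ℤ × ℤ)} : ∀ {u v : ℤ × ℤ}, UP γ u v → ∀ w ∈ γ,
    u.1 ≤ w.1 ∧ u.2 ≤ w.2 ∧ w.1 ≤ v.1 ∧ w.2 ≤ v.2 := by
  induction γ with
  | nil => intro u v h; exact absurd rfl (up_ne_nil h)
  | cons a l ih =>
    cases l with
    | nil =>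
      intro u v h w hw
      rw [up_singleton] at h
      obtain ⟨rfl, rfl⟩ := h
      simp at hw
      simp [hw]
    | cons b l =>
      intro u v h w hw
      rw [up_cons_cons] at h
      obtain ⟨rfl, h1, h2⟩ := h
      have hb := ih h2 b (by simp)
      rcases List.mem_cons.1 hw with rfl | hw
      · rcases h1 with h1 | h1 <;> omega
      · have := ih h2 w hw
        rcases h1 with h1 | h1 <;> omega

lemma up_le {γ : List (ℤ × ℤ)} {u v : ℤ × ℤ} (h : UP γ u v) : u.1 ≤ v.1 ∧ u.2 ≤ v.2 := by
  cases γ with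
  | nil => exact absurd rfl (up_ne_nil h)
  | cons a l => have := up_mem h a (by simp); omega

lemma up_head {γ : List (ℤ × ℤ)} {u v : ℤ × ℤ} (h : UP γ u v) : ∃ l, γ = u :: l := by
  cases γ with
  | nil => exact absurd rfl (up_ne_nil h)
  | cons a l =>
    have := h.1
    simp at this
    exact ⟨l, by rw [this]⟩

lemma up_nodup {γ : List (ℤ × ℤ)} : ∀ {u v : ℤ × ℤ}, UP γ u v → γ.Nodup := by
  induction γ with
  | nil => intro u v h; simp
  | cons a l ih =>
    cases l with
    | nil => intros; simp
    | cons b l =>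
      intro u v h
      rw [up_cons_cons] at h
      obtain ⟨rfl, h1, h2⟩ := h
      rw [List.nodup_cons]
      refine ⟨fun hm => ?_, ih h2⟩
      have := up_mem h2 a hm
      rcases h1 with h1 | h1 <;> omega

lemma up_length {γ : List (ℤ × ℤ)} : ∀ {u v : ℤ × ℤ}, UP γ u v →
    (γ.length : ℤ) = v.1 + v.2 - u.1 - u.2 + 1 := by
  induction γ with
  | nil => intro u v h; exact absurd rfl (up_ne_nil h)
  | cons a l ih =>
    cases l with
    | nil =>
      intro u v h
      rw [up_singleton] at h
      obtain ⟨rfl, rfl⟩ := h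
      simp
    | cons b l =>
      intro u v h
      rw [up_cons_cons] at h
      obtain ⟨rfl, h1, h2⟩ := h
      have := ih h2
      simp only [List.length_cons] at this ⊢
      push_cast at this ⊢
      rcases h1 with h1 | h1 <;> omega

lemma finite_len (N : ℕ) : ∀ u v : ℤ × ℤ, {γ | UP γ u v ∧ γ.length = N}.Finite := by
  induction N with
  | zero =>
    intro u v
    refine Set.Finite.subset (Set.finite_singleton []) ?_
    rintro γ ⟨-, h⟩
    simpa using h
  | succ N ih =>
    intro u v
    refine Set.Finite.subset (((Set.finite_singleton [u])).union
      (((ih (u.1 + 1, u.2) v).union (ih (u.1, u.2 + 1) v)).image (fun l => u :: l))) ?_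
    rintro γ ⟨h, hl⟩
    cases γ with
    | nil => exact absurd rfl (up_ne_nil h)
    | cons a l =>
      cases l with
      | nil =>
        rw [up_singleton] at h
        left; simp [h.1]
      | cons b l =>
        rw [up_cons_cons] at h
        obtain ⟨rfl, h1, h2⟩ := h
        right
        refine ⟨b :: l, ?_, rfl⟩
        simp only [List.length_cons] at hl
        rcases h1 with h1 | h1
        · left
          have : b = (a.1 + 1, a.2) := Prod.ext h1.1 h1.2
          rw [← this]
          exact ⟨h2, by simp; omega⟩
        · right
          have : b = (a.1, a.2 + 1) := Prod.ext h1.1 h1.2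
          rw [← this]
          exact ⟨h2, by simp; omega⟩

lemma finite_up (u v : ℤ × ℤ) : {γ | UP γ u v}.Finite := by
  refine (finite_len (v.1 + v.2 - u.1 - u.2 + 1).toNat u v).subset ?_
  intro γ h
  refine ⟨h, ?_⟩
  have := up_length h
  omega

noncomputable def paths (u v : ℤ × ℤ) : Finset (List (ℤ × ℤ)) := (finite_up u v).toFinset

@[simp] lemma mem_paths {γ : List (ℤ × ℤ)} {u v : ℤ × ℤ} : γ ∈ paths u v ↔ UP γ u v := by
  simp [paths]

noncomputable def wt (X : ℤ × ℤ → ℝ) (γ : List (ℤ × ℤ)) : ℝ := (γ.map X).prod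

noncomputable def P (X : ℤ × ℤ → ℝ) (u v : ℤ × ℤ) : ℝ := ∑ γ ∈ paths u v, wt X γ

lemma P_rec (X : ℤ × ℤ → ℝ) (u : ℤ × ℤ) (x y : ℤ) (h : u ≠ (x, y)) :
    P X u (x, y) = X (x, y) * (P X u (x - 1, y) + P X u (x, y - 1)) := by
  classical
  have hu : paths u (x, y) =
      (paths u (x - 1, y) ∪ paths u (x, y - 1)).image (fun A => A ++ [(x, y)]) := by
    ext γ
    simp only [mem_paths, Finset.mem_image, Finset.mem_union]
    constructor
    · intro hγ
      obtain ⟨A, w, rfl, hw, hA⟩ := up_snoc_inv hγ h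
      refine ⟨A, ?_, rfl⟩
      rcases hw with hw | hw
      · left
        have : w = (x - 1, y) := by ext <;> simp at hw ⊢ <;> omega
        rwa [← this]
      · right
        have : w = (x, y - 1) := by ext <;> simp at hw ⊢ <;> omega
        rwa [← this]
    · rintro ⟨A, hA | hA, rfl⟩
      · exact up_snoc (by left; simp) hA
      · exact up_snoc (by right; simp) hA
  have hd : Disjoint (paths u (x - 1, y)) (paths u (x, y - 1)) := by
    rw [Finset.disjoint_left]
    intro A h1 h2
    rw [mem_paths] at h1 h2
    have := h1.2.1.symm.trans h2.2.1
    simp at this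
  unfold P
  rw [hu, Finset.sum_image (by intro a _ b _ hab; simpa using hab), Finset.sum_union hd,
    mul_add, Finset.mul_sum, Finset.mul_sum]
  congr 1 <;> refine Finset.sum_congr rfl fun A _ => ?_ <;> simp [wt, mul_comm]

/-- Synchronized crossing. -/
lemma cross_sync {γ : List (ℤ × ℤ)} : ∀ {δ : List (ℤ × ℤ)} {g d p q : ℤ × ℤ},
    UP γ g p → UP δ d q → g.1 + g.2 = d.1 + d.2 → g.1 ≤ d.1 →
    ((p.1 + p.2 ≤ q.1 + q.2 ∧ q.1 ≤ p.1) ∨ (q.1 + q.2 ≤ p.1 + p.2 ∧ p.2 ≤ q.2)) →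
    ∃ w, w ∈ γ ∧ w ∈ δ := by
  induction γ with
  | nil => intro δ g d p q h; exact absurd rfl (up_ne_nil h)
  | cons a l ih =>
    intro δ g d p q hγ hδ hs hle hor
    have ha : a = g := by simpa using hγ.1
    obtain ⟨t, rfl⟩ := up_head hδ
    by_cases hgd : g = d
    · exact ⟨a, by simp, by simp [ha, hgd]⟩
    have hlt : g.1 < d.1 := by
      rcases lt_or_eq_of_le hle with h | h
      · exact h
      · exact absurd (Prod.ext h (by omega)) hgd
    have h1 := up_le hγ
    have h2 := up_le hδ
    cases l with
    | nil =>
      rw [up_singleton] at hγ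
      obtain ⟨rfl, rfl⟩ := hγ
      exfalso; omega
    | cons b l =>
      cases t with
      | nil =>
        rw [up_singleton] at hδ
        obtain ⟨-, rfl⟩ := hδ
        exfalso; omega
      | cons c t =>
        rw [up_cons_cons] at hγ hδ
        obtain ⟨w, hw1, hw2⟩ := ih hγ.2.2 hδ.2.2
          (by rcases hγ.2.1 with h | h <;> rcases hδ.2.1 with h' | h' <;> omega)
          (by rcases hγ.2.1 with h | h <;> rcases hδ.2.1 with h' | h' <;> omega) hor
        exact ⟨w, List.mem_cons_of_mem _ hw1, List.mem_cons_of_mem _ hw2⟩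

lemma cross {γ : List (ℤ × ℤ)} : ∀ {δ : List (ℤ × ℤ)} {g d p q : ℤ × ℤ},
    UP γ g p → UP δ d q → g.1 + g.2 ≤ d.1 + d.2 → d.2 ≤ g.2 → d.1 + d.2 ≤ p.1 + p.2 →
    ((p.1 + p.2 ≤ q.1 + q.2 ∧ q.1 ≤ p.1) ∨ (q.1 + q.2 ≤ p.1 + p.2 ∧ p.2 ≤ q.2)) →
    ∃ w, w ∈ γ ∧ w ∈ δ := by
  induction γ with
  | nil => intro δ g d p q h; exact absurd rfl (up_ne_nil h)
  | cons a l ih =>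
    intro δ g d p q hγ hδ hs hle hp hor
    by_cases he : g.1 + g.2 = d.1 + d.2
    · exact cross_sync hγ hδ he (by omega) hor
    cases l with
    | nil =>
      rw [up_singleton] at hγ
      obtain ⟨rfl, rfl⟩ := hγ
      omega
    | cons b l =>
      rw [up_cons_cons] at hγ
      obtain ⟨w, hw1, hw2⟩ := ih hγ.2.2 hδ
          (by rcases hγ.2.1 with h | h <;> omega)
          (by rcases hγ.2.1 with h | h <;> omega) hp hor
      exact ⟨w, List.mem_cons_of_mem _ hw1, hw2⟩

lemma exists_hpath (d : ℕ) : ∀ x y : ℤ, ∃ γ, UP γ (x, y) (x + d, y) ∧ ∀ w ∈ γ, w.2 = y ∧ x ≤ w.1 := by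
  induction d with
  | zero => intro x y; exact ⟨[(x, y)], by simp [up_singleton], by simp⟩
  | succ d ih =>
    intro x y
    obtain ⟨γ, h, hw⟩ := ih x y
    refine ⟨γ ++ [(x + (d + 1 : ℕ), y)], up_snoc (by left; push_cast; simp; ring) h, ?_⟩
    intro w hm
    rcases List.mem_append.1 hm with hm | hm
    · exact hw w hm
    · simp at hm; subst hm; simp; omega

/-- up then right -/
lemma exists_lpath (d e : ℕ) : ∀ x y : ℤ, ∃ γ, UP γ (x, y) (x + e, y + d) ∧
    ∀ w ∈ γ, (w.1 = x ∧ w.2 ≤ y + d) ∨ (w.2 = y + d ∧ x ≤ w.1) := by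
  induction d with
  | zero =>
    intro x y
    obtain ⟨γ, h, hw⟩ := exists_hpath e x y
    exact ⟨γ, by simpa using h, fun w hm => by right; simpa using hw w hm⟩
  | succ d ih =>
    intro x y
    obtain ⟨γ, h, hw⟩ := ih x (y + 1)
    obtain ⟨l, rfl⟩ := up_head h
    refine ⟨(x, y) :: (x, y + 1) :: l, ?_, ?_⟩
    · rw [up_cons_cons]
      refine ⟨rfl, by right; simp, ?_⟩
      convert h using 2
      push_cast; ring
    · intro w hm
      rcases List.mem_cons.1 hm with rfl | hm
      · left; simp; omega
      · rcases hw w hm with h | h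
        · left; push_cast; omega
        · right; push_cast; omega

end CrossDec


namespace CrossDec

open Equiv

/-- part before `w` -/
def tk (w : ℤ × ℤ) (l : List (ℤ × ℤ)) : List (ℤ × ℤ) := l.takeWhile (fun x => decide (x ≠ w))
/-- part from `w` on -/
def dp (w : ℤ × ℤ) (l : List (ℤ × ℤ)) : List (ℤ × ℤ) := l.dropWhile (fun x => decide (x ≠ w))

lemma tk_dp (w : ℤ × ℤ) (l : List (ℤ × ℤ)) : tk w l ++ dp w l = l := by
  simp [tk, dp]

lemma dp_eq {w : ℤ × ℤ} {l : List (ℤ × ℤ)} (h : w ∈ l) : ∃ B, dp w l = w :: B := by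
  induction l with
  | nil => simp at h
  | cons a l ih =>
    by_cases ha : a = w
    · exact ⟨l, by simp [dp, ha]⟩
    · obtain ⟨B, hB⟩ := ih (by rcases List.mem_cons.1 h with h | h; exact absurd h.symm ha; exact h)
      exact ⟨B, by rw [← hB]; simp [dp, ha]⟩

lemma not_mem_tk (w : ℤ × ℤ) (l : List (ℤ × ℤ)) : ∀ x ∈ tk w l, x ≠ w := by
  intro x hx
  have := List.mem_takeWhile_imp hx
  simpa using this

lemma tk_append {w : ℤ × ℤ} {A B : List (ℤ × ℤ)} (h : ∀ x ∈ A, x ≠ w) :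
    tk w (A ++ w :: B) = A := by
  unfold tk
  rw [List.takeWhile_append_of_pos (by simpa using h)]
  simp

lemma dp_append {w : ℤ × ℤ} {A B : List (ℤ × ℤ)} (h : ∀ x ∈ A, x ≠ w) :
    dp w (A ++ w :: B) = w :: B := by
  unfold dp
  rw [List.dropWhile_append_of_pos (by simpa using h)]
  simp

variable {k : ℕ}

/-- swap tails of the `i`-th and `j`-th path after `w` -/
def sw (w : ℤ × ℤ) (i j : Fin k) (γ : Fin k → List (ℤ × ℤ)) : Fin k → List (ℤ × ℤ) :=
  fun l => if l = i then tk w (γ i) ++ dp w (γ j)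
    else if l = j then tk w (γ j) ++ dp w (γ i) else γ l

lemma sw_sw {w : ℤ × ℤ} {i j : Fin k} {γ : Fin k → List (ℤ × ℤ)} (hij : i ≠ j)
    (hi : w ∈ γ i) (hj : w ∈ γ j) : sw w i j (sw w i j γ) = γ := by
  obtain ⟨B, hB⟩ := dp_eq hi
  obtain ⟨D, hD⟩ := dp_eq hj
  have e1 : sw w i j γ i = tk w (γ i) ++ w :: D := by simp [sw, hD]
  have e2 : sw w i j γ j = tk w (γ j) ++ w :: B := by simp [sw, hB, hij.symm]
  funext l
  by_cases h1 : l = i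
  · subst h1
    rw [sw, if_pos rfl, e1, e2, tk_append (not_mem_tk _ _), dp_append (not_mem_tk _ _), ← hB, tk_dp]
  · by_cases h2 : l = j
    · subst h2
      rw [sw, if_neg h1, if_pos rfl, e1, e2, tk_append (not_mem_tk _ _),
        dp_append (not_mem_tk _ _), ← hD, tk_dp]
    · simp [sw, h1, h2]

lemma mem_sw {w : ℤ × ℤ} {i j : Fin k} {γ : Fin k → List (ℤ × ℤ)}
    (hi : w ∈ γ i) (hj : w ∈ γ j) (l : Fin k) : w ∈ sw w i j γ l ↔ w ∈ γ l := by
  obtain ⟨B, hB⟩ := dp_eq hi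
  obtain ⟨D, hD⟩ := dp_eq hj
  unfold sw
  split_ifs with h1 h2
  · subst h1; simp [hD, hi]
  · subst h2; simp [hB, hj]
  · rfl

/-- `v` is shared by two distinct paths -/
def Shared (γ : Fin k → List (ℤ × ℤ)) (v : ℤ × ℤ) : Prop :=
  ∃ p : Fin k × Fin k, p.1 ≠ p.2 ∧ v ∈ γ p.1 ∧ v ∈ γ p.2

lemma shared_sw {w : ℤ × ℤ} {i j : Fin k} {γ : Fin k → List (ℤ × ℤ)} (hij : i ≠ j)
    (hnd : ∀ l, (sw w i j γ l).Nodup) {v : ℤ × ℤ} (h : Shared γ v) : Shared (sw w i j γ) v := by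
  have e1 : sw w i j γ i = tk w (γ i) ++ dp w (γ j) := by simp [sw]
  have e2 : sw w i j γ j = tk w (γ j) ++ dp w (γ i) := by simp [sw, hij.symm]
  have e3 : ∀ l, l ≠ i → l ≠ j → sw w i j γ l = γ l := fun l h1 h2 => by simp [sw, h1, h2]
  have n1 := hnd i
  have n2 := hnd j
  rw [e1, List.nodup_append] at n1
  rw [e2, List.nodup_append] at n2
  have m1 : v ∈ γ i ↔ v ∈ tk w (γ i) ∨ v ∈ dp w (γ i) := by
    rw [← List.mem_append, tk_dp]
  have m2 : v ∈ γ j ↔ v ∈ tk w (γ j) ∨ v ∈ dp w (γ j) := by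
    rw [← List.mem_append, tk_dp]
  have m1' : v ∈ sw w i j γ i ↔ v ∈ tk w (γ i) ∨ v ∈ dp w (γ j) := by
    rw [← List.mem_append, e1]
  have m2' : v ∈ sw w i j γ j ↔ v ∈ tk w (γ j) ∨ v ∈ dp w (γ i) := by
    rw [← List.mem_append, e2]
  have d1 : ¬ (v ∈ tk w (γ i) ∧ v ∈ dp w (γ j)) := fun h => n1.2.2 v h.1 v h.2 rfl
  have d2 : ¬ (v ∈ tk w (γ j) ∧ v ∈ dp w (γ i)) := fun h => n2.2.2 v h.1 v h.2 rfl
  have key : ∀ l, l ≠ i → l ≠ j → v ∈ γ l → (v ∈ γ i ∨ v ∈ γ j) → Shared (sw w i j γ) v := by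
    intro l h1 h2 hl hv
    have hl' : v ∈ sw w i j γ l := by rw [e3 l h1 h2]; exact hl
    have : v ∈ sw w i j γ i ∨ v ∈ sw w i j γ j := by
      rw [m1', m2']; rw [m1, m2] at hv
      rcases hv with (h | h) | (h | h) <;> simp [h]
    rcases this with h | h
    · exact ⟨(l, i), h1, hl', h⟩
    · exact ⟨(l, j), h2, hl', h⟩
  have key2 : v ∈ γ i → v ∈ γ j → Shared (sw w i j γ) v := by
    intro h1 h2
    refine ⟨(i, j), hij, m1'.2 ?_, m2'.2 ?_⟩ <;> rw [m1] at h1 <;> rw [m2] at h2 <;>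
      clear m1 m2 m1' m2' key n1 n2 <;> rcases h1 with h1 | h1 <;> rcases h2 with h2 | h2 <;>
      simp_all
  obtain ⟨⟨p, q⟩, hpq, hp, hq⟩ := h
  dsimp only at hpq hp hq
  by_cases hpi : p = i
  · subst hpi
    by_cases hqj : q = j
    · subst hqj; exact key2 hp hq
    · exact key q (Ne.symm hpq) hqj hq (Or.inl hp)
  · by_cases hpj : p = j
    · subst hpj
      by_cases hqi : q = i
      · subst hqi; exact key2 hq hp
      · exact key q hqi (Ne.symm hpq) hq (Or.inr hp)
    · by_cases hqi : q = i
      · subst hqi; exact key p hpi hpj hp (Or.inl hq)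
      · by_cases hqj : q = j
        · subst hqj; exact key p hpi hpj hp (Or.inr hq)
        · exact ⟨(p, q), hpq, by rw [e3 p hpi hpj]; exact hp, by rw [e3 q hqi hqj]; exact hq⟩

lemma wt_append (X : ℤ × ℤ → ℝ) (A B : List (ℤ × ℤ)) : wt X (A ++ B) = wt X A * wt X B := by
  simp [wt]

lemma prod_split (i j : Fin k) (hij : i ≠ j) (f : Fin k → ℝ) :
    ∏ l, f l = f i * (f j * ∏ l ∈ (Finset.univ.erase i).erase j, f l) := by
  rw [Finset.mul_prod_erase (Finset.univ.erase i) f (by simp [hij.symm]),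
    Finset.mul_prod_erase Finset.univ f (by simp)]

lemma wt_sw (X : ℤ × ℤ → ℝ) (w : ℤ × ℤ) (i j : Fin k) (γ : Fin k → List (ℤ × ℤ)) (hij : i ≠ j) :
    ∏ l, wt X (sw w i j γ l) = ∏ l, wt X (γ l) := by
  rw [prod_split i j hij, prod_split i j hij (fun l => wt X (γ l))]
  have e1 : sw w i j γ i = tk w (γ i) ++ dp w (γ j) := by simp [sw]
  have e2 : sw w i j γ j = tk w (γ j) ++ dp w (γ i) := by simp [sw, hij.symm]
  have e3 : ∏ l ∈ (Finset.univ.erase i).erase j, wt X (sw w i j γ l) =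
      ∏ l ∈ (Finset.univ.erase i).erase j, wt X (γ l) := by
    refine Finset.prod_congr rfl fun l hl => ?_
    simp at hl
    simp [sw, hl]
  rw [e1, e2, e3, wt_append, wt_append]
  have f1 : wt X (γ i) = wt X (tk w (γ i)) * wt X (dp w (γ i)) := by rw [← wt_append, tk_dp]
  have f2 : wt X (γ j) = wt X (tk w (γ j)) * wt X (dp w (γ j)) := by rw [← wt_append, tk_dp]
  rw [f1, f2]
  ring

lemma up_swap {γ δ : List (ℤ × ℤ)} {u v u' v' w : ℤ × ℤ} (hγ : UP γ u v) (hδ : UP δ u' v')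
    (h1 : w ∈ γ) (h2 : w ∈ δ) : UP (tk w γ ++ dp w δ) u v' := by
  obtain ⟨B, hB⟩ := dp_eq h1
  obtain ⟨D, hD⟩ := dp_eq h2
  rw [← tk_dp w γ, hB, up_split] at hγ
  rw [← tk_dp w δ, hD, up_split] at hδ
  rw [hD, up_split]
  exact ⟨hγ.1, hδ.2⟩

lemma up_sw {γ : Fin k → List (ℤ × ℤ)} {u v : Fin k → ℤ × ℤ} {σ : Perm (Fin k)}
    (h : ∀ l, UP (γ l) (u l) (v (σ l))) {w : ℤ × ℤ} {i j : Fin k}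
    (hi : w ∈ γ i) (hj : w ∈ γ j) (l : Fin k) :
    UP (sw w i j γ l) (u l) (v ((σ * swap i j) l)) := by
  unfold sw
  split_ifs with h1 h2
  · subst h1; simpa using up_swap (h l) (h j) hi hj
  · subst h2; simpa using up_swap (h l) (h i) hj hi
  · rw [Perm.mul_apply, swap_apply_of_ne_of_ne h1 h2]; exact h l

/-- chosen shared vertex -/
noncomputable def cw (γ : Fin k → List (ℤ × ℤ)) : ℤ × ℤ := Classical.epsilon (Shared γ)

/-- chosen pair of indices -/
noncomputable def cp [Nonempty (Fin k × Fin k)] (γ : Fin k → List (ℤ × ℤ)) (w : ℤ × ℤ) :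
    Fin k × Fin k :=
  Classical.epsilon (fun p : Fin k × Fin k => p.1 ≠ p.2 ∧ w ∈ γ p.1 ∧ w ∈ γ p.2)

noncomputable def inv [Nonempty (Fin k × Fin k)] (x : (_ : Perm (Fin k)) × (Fin k → List (ℤ × ℤ))) :
    (_ : Perm (Fin k)) × (Fin k → List (ℤ × ℤ)) :=
  let w := cw x.2
  let p := cp x.2 w
  ⟨x.1 * swap p.1 p.2, sw w p.1 p.2 x.2⟩

lemma cp_spec [Nonempty (Fin k × Fin k)] {γ : Fin k → List (ℤ × ℤ)} (h : ∃ w, Shared γ w) :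
    (cp γ (cw γ)).1 ≠ (cp γ (cw γ)).2 ∧ cw γ ∈ γ (cp γ (cw γ)).1 ∧ cw γ ∈ γ (cp γ (cw γ)).2 := by
  have h1 : Shared γ (cw γ) := Classical.epsilon_spec h
  exact Classical.epsilon_spec h1

lemma inv_inv [Nonempty (Fin k × Fin k)] {u v : Fin k → ℤ × ℤ}
    {x : (_ : Perm (Fin k)) × (Fin k → List (ℤ × ℤ))}
    (hx : ∀ l, UP (x.2 l) (u l) (v (x.1 l))) (h : ∃ w, Shared x.2 w) :
    (∃ w, Shared (inv x).2 w) ∧ inv (inv x) = x := by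
  obtain ⟨σ, γ⟩ := x
  dsimp only at hx h
  obtain ⟨hij, hi, hj⟩ := cp_spec h
  have e1 : (inv ⟨σ, γ⟩ : (_ : Perm (Fin k)) × (Fin k → List (ℤ × ℤ))) =
    ⟨σ * swap (cp γ (cw γ)).1 (cp γ (cw γ)).2, sw (cw γ) (cp γ (cw γ)).1 (cp γ (cw γ)).2 γ⟩ := rfl
  generalize hw : cw γ = w at *
  generalize hp : cp γ w = p at *
  obtain ⟨i, j⟩ := p
  dsimp only at *
  have hnd : ∀ l, (sw w i j γ l).Nodup := fun l => up_nodup (up_sw hx hi hj l)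
  have hS : Shared (sw w i j γ) = Shared γ := by
    funext v
    apply propext
    constructor
    · intro hv
      have := shared_sw (w := w) (i := i) (j := j) (γ := sw w i j γ) hij
        (by rw [sw_sw hij hi hj]; exact fun l => up_nodup (hx l)) hv
      rwa [sw_sw hij hi hj] at this
    · exact shared_sw hij hnd
  have hw' : cw (sw w i j γ) = w := by rw [cw, hS]; exact hw
  have hp' : cp (sw w i j γ) w = (i, j) := by
    rw [cp]
    simp only [mem_sw hi hj]
    exact hp
  rw [e1]
  refine ⟨by dsimp only; rw [hS]; exact h, ?_⟩
  unfold inv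
  dsimp only
  rw [hw', hp']
  dsimp only
  rw [sw_sw hij hi hj, mul_assoc, swap_mul_self, mul_one]

lemma tupleWeight_eq (X : ℤ × ℤ → ℝ) {γ : Fin k → List (ℤ × ℤ)}
    (hd : ¬ ∃ w, Shared γ w) (hn : ∀ l, (γ l).Nodup) :
    tupleWeight X γ = ∏ l, wt X (γ l) := by
  unfold tupleWeight
  rw [Finset.prod_biUnion]
  · refine Finset.prod_congr rfl fun l _ => ?_
    rw [List.prod_toFinset _ (hn l)]
    rfl
  · intro i _ j _ hij
    rw [Function.onFun, Finset.disjoint_left]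
    intro w hi hj
    exact hd ⟨w, (i, j), hij, by simpa using hi, by simpa using hj⟩

lemma TT_eq_sum [DecidablePred fun γ : Fin k → List (ℤ × ℤ) => ∃ w, Shared γ w]
    (X : ℤ × ℤ → ℝ) (u v : Fin k → ℤ × ℤ) :
    TT X u v = ∑ γ ∈ (Fintype.piFinset (fun i => paths (u i) (v i))).filter
      (fun γ => ¬ ∃ w, Shared γ w), ∏ l, wt X (γ l) := by
  have hs : DisjointPathTuples UpStep u v = ((Fintype.piFinset
      (fun i => paths (u i) (v i))).filter (fun γ => ¬ ∃ w, Shared γ w) : Finset _) := by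
    ext γ
    simp only [DisjointPathTuples, Set.mem_ofPred_eq, Finset.coe_filter, Fintype.mem_piFinset,
      mem_paths]
    refine and_congr Iff.rfl ?_
    constructor
    · rintro h ⟨w, p, hp, h1, h2⟩
      exact h _ _ hp w h1 h2
    · intro h i j hij w h1 h2
      exact h ⟨w, (i, j), hij, h1, h2⟩
  unfold TT dirPF
  rw [hs, Finset.tsum_subtype']
  refine Finset.sum_congr rfl fun γ hγ => ?_
  simp only [Finset.mem_filter, Fintype.mem_piFinset, mem_paths] at hγ
  exact tupleWeight_eq X hγ.2 (fun l => up_nodup (hγ.1 l))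

/-- Lindström–Gessel–Viennot. -/
theorem lgv (X : ℤ × ℤ → ℝ) (u v : Fin k → ℤ × ℤ)
    (hcross : ∀ σ : Perm (Fin k), σ ≠ 1 → ∀ γ : Fin k → List (ℤ × ℤ),
      (∀ l, UP (γ l) (u l) (v (σ l))) → ∃ w, Shared γ w) :
    TT X u v = Matrix.det (Matrix.of fun i j => P X (u i) (v j)) := by
  classical
  have hdet : Matrix.det (Matrix.of fun i j => P X (u i) (v j)) =
      ∑ x ∈ (Finset.univ : Finset (Perm (Fin k))).sigma
        (fun σ => Fintype.piFinset (fun i => paths (u i) (v (σ i)))),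
        ((Perm.sign x.1 : ℤ) : ℝ) * ∏ l, wt X (x.2 l) := by
    rw [← Matrix.det_transpose, Matrix.det_apply', Finset.sum_sigma]
    refine Finset.sum_congr rfl fun σ _ => ?_
    simp only [Matrix.transpose_apply, Matrix.of_apply, P]
    rw [Finset.prod_univ_sum, Finset.mul_sum]
  rw [hdet, ← Finset.sum_filter_add_sum_filter_not _ (fun x => ∃ w, Shared x.2 w)]
  have h0 : ∑ x ∈ ((Finset.univ : Finset (Perm (Fin k))).sigma
        (fun σ => Fintype.piFinset (fun i => paths (u i) (v (σ i))))).filter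
          (fun x => ∃ w, Shared x.2 w),
        ((Perm.sign x.1 : ℤ) : ℝ) * ∏ l, wt X (x.2 l) = 0 := by
    by_cases hne : Nonempty (Fin k × Fin k)
    · have hmem : ∀ x : (_ : Perm (Fin k)) × (Fin k → List (ℤ × ℤ)),
          x ∈ ((Finset.univ : Finset (Perm (Fin k))).sigma
          (fun σ => Fintype.piFinset (fun i => paths (u i) (v (σ i))))).filter
          (fun x => ∃ w, Shared x.2 w) ↔
          (∀ l, UP (x.2 l) (u l) (v (x.1 l))) ∧ ∃ w, Shared x.2 w := by
        intro x
        simp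
      have hsum : ∀ x : (_ : Perm (Fin k)) × (Fin k → List (ℤ × ℤ)),
          (∀ l, UP (x.2 l) (u l) (v (x.1 l))) ∧ (∃ w, Shared x.2 w) →
          (((Perm.sign x.1 : ℤ) : ℝ) * ∏ l, wt X (x.2 l)) +
            (((Perm.sign (inv x).1 : ℤ) : ℝ) * ∏ l, wt X ((inv x).2 l)) = 0 := by
        rintro ⟨σ, γ⟩ ⟨h1, h2⟩
        obtain ⟨hij, hi, hj⟩ := cp_spec h2
        simp only [inv]
        rw [wt_sw X _ _ _ _ hij, Perm.sign_mul, Perm.sign_swap hij]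
        simp
      refine Finset.sum_involution (fun x _ => inv x) ?_ ?_ ?_ ?_
      · intro x hx
        exact hsum x ((hmem x).1 hx)
      · intro x hx hf heq
        have := hsum x ((hmem x).1 hx)
        rw [heq] at this
        apply hf
        linarith
      · intro x hx
        rw [hmem] at hx ⊢
        refine ⟨?_, (inv_inv hx.1 hx.2).1⟩
        obtain ⟨hij, hi, hj⟩ := cp_spec hx.2
        exact fun l => up_sw hx.1 hi hj l
      · intro x hx
        rw [hmem] at hx
        exact (inv_inv hx.1 hx.2).2
    · refine Finset.sum_eq_zero fun x hx => ?_
      rw [Finset.mem_filter] at hx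
      obtain ⟨-, w, p, -⟩ := hx
      exact absurd ⟨p⟩ hne
  rw [h0, zero_add, TT_eq_sum]
  refine Finset.sum_bij (fun γ _ => ⟨1, γ⟩) ?_ ?_ ?_ ?_
  · intro γ hγ
    simpa using hγ
  · intro a _ b _ hab
    simpa using hab
  · rintro ⟨σ, γ⟩ hx
    simp only [Finset.mem_filter, Finset.mem_sigma, Finset.mem_univ, true_and,
      Fintype.mem_piFinset, mem_paths] at hx
    by_cases hσ : σ = 1
    · subst hσ
      refine ⟨γ, ?_, rfl⟩
      simpa using hx
    · exact absurd (hcross σ hσ γ hx.1) hx.2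
  · intro γ _
    simp

end CrossDec


namespace CrossDec

open Matrix

/-- leading minor -/
noncomputable def Del (M : ℤ → ℤ → ℝ) (r s : ℕ → ℤ) (k : ℕ) : ℝ :=
  det (of fun i j : Fin k => M (r i) (s j))

/-- replace the `k`-th entry -/
def ext (r : ℕ → ℤ) (k : ℕ) (a : ℤ) (i : ℕ) : ℤ := if i = k then a else r i

/-- bordered minor -/
noncomputable def D (M : ℤ → ℤ → ℝ) (r s : ℕ → ℤ) (k : ℕ) (a c : ℤ) : ℝ :=
  det (of fun i j : Fin (k + 1) => M (ext r k a i) (ext s k c j))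

lemma schur (M : ℤ → ℤ → ℝ) (r s : ℕ → ℤ) (k : ℕ) (h : Del M r s k ≠ 0) :
    ∃ S : ℤ → ℤ → ℝ, ∀ (p : ℕ) (f g : Fin p → ℤ),
      det (of fun i j : Fin (k + p) => M (Fin.append (fun l : Fin k => r l) f i)
        (Fin.append (fun l : Fin k => s l) g j)) =
      Del M r s k * det (of fun i j => S (f i) (g j)) := by
  let A : Matrix (Fin k) (Fin k) ℝ := of fun i j : Fin k => M (r i) (s j)
  haveI : Invertible A := invertibleOfIsUnitDet A (isUnit_iff_ne_zero.2 h)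
  refine ⟨fun a c => M a c - ∑ j, (∑ i : Fin k, M a (s i) * (⅟A) i j) * M (r j) c, ?_⟩
  intro p f g
  rw [← det_submatrix_equiv_self finSumFinEquiv]
  have : (of fun i j : Fin (k + p) => M (Fin.append (fun l : Fin k => r l) f i)
        (Fin.append (fun l : Fin k => s l) g j)).submatrix finSumFinEquiv finSumFinEquiv =
      fromBlocks A (of fun i j => M (r i) (g j)) (of fun i j => M (f i) (s j))
        (of fun i j => M (f i) (g j)) := by
    ext i j
    rcases i with i | i <;> rcases j with j | j <;> simp [A]
  rw [this, det_fromBlocks₁₁]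
  congr 2

lemma syl (M : ℤ → ℤ → ℝ) (r s : ℕ → ℤ) (k : ℕ) (h : Del M r s k ≠ 0) :
    ∃ S : ℤ → ℤ → ℝ, (∀ a c, D M r s k a c = Del M r s k * S a c) ∧
      (∀ a c, D M r s (k + 1) a c =
        Del M r s k * (S (r k) (s k) * S a c - S (r k) c * S a (s k))) := by
  obtain ⟨S, hS⟩ := schur M r s k h
  have e1 : ∀ (r : ℕ → ℤ) (a : ℤ) (i : Fin (k + 1)),
      Fin.append (fun l : Fin k => r l) (fun _ : Fin 1 => a) i = ext r k a i := by
    intro r a i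
    induction i using Fin.addCases with
    | left i => have := i.2; simp [ext, this.ne]
    | right i => simp [ext]
  have e2 : ∀ (r : ℕ → ℤ) (a : ℤ) (i : Fin (k + 2)),
      Fin.append (fun l : Fin k => r l) ![r k, a] i = ext r (k + 1) a i := by
    intro r a i
    induction i using Fin.addCases with
    | left i =>
      have := i.2
      have h2 : (i : ℕ) ≠ k + 1 := by omega
      simp [ext, h2]
    | right i => fin_cases i <;> simp [ext]
  refine ⟨S, fun a c => ?_, fun a c => ?_⟩
  · have := hS 1 (fun _ => a) (fun _ => c)
    simp only [e1] at this
    rw [D, this]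
    simp
  · have := hS 2 ![r k, a] ![s k, c]
    simp only [e2] at this
    rw [D, this, det_fin_two]
    simp

lemma D_diag (M : ℤ → ℤ → ℝ) (r s : ℕ → ℤ) (k : ℕ) :
    D M r s k (r k) (s k) = Del M r s (k + 1) := by
  have : ∀ (r : ℕ → ℤ) i, ext r k (r k) i = r i := by
    intro r i; unfold ext; split_ifs with h <;> simp [h]
  simp [D, Del, this]

lemma D_row (M : ℤ → ℤ → ℝ) (r s : ℕ → ℤ) (k : ℕ) (c : ℤ) (i : ℕ) (hi : i < k) :
    D M r s k (r i) c = 0 := by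
  refine det_zero_of_row_eq (i := ⟨i, by omega⟩) (j := ⟨k, by omega⟩) ?_ ?_
  · simp; omega
  · funext j
    have := hi.ne
    simp [ext, this]

lemma D_col (M : ℤ → ℤ → ℝ) (r s : ℕ → ℤ) (k : ℕ) (a : ℤ) (i : ℕ) (hi : i < k) :
    D M r s k a (s i) = 0 := by
  refine det_zero_of_column_eq (i := ⟨i, by omega⟩) (j := ⟨k, by omega⟩) ?_ ?_
  · simp; omega
  · intro j
    have := hi.ne
    simp [ext, this]

/-- `LU` expansion. -/
lemma lu (M : ℤ → ℤ → ℝ) (r s : ℕ → ℤ) (K : ℕ) (a c : ℤ)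
    (hΔ : ∀ k ≤ K, Del M r s k ≠ 0) (h0 : D M r s K a c = 0) :
    M a c = ∑ k ∈ Finset.range K,
      D M r s k a (s k) * D M r s k (r k) c / (Del M r s (k + 1) * Del M r s k) := by
  have hstep : ∀ k ∈ Finset.range K,
      D M r s k a (s k) * D M r s k (r k) c / (Del M r s (k + 1) * Del M r s k) =
      D M r s k a c / Del M r s k - D M r s (k + 1) a c / Del M r s (k + 1) := by
    intro k hk
    rw [Finset.mem_range] at hk
    have h1 := hΔ k (by omega)
    have h2 := hΔ (k + 1) (by omega)
    obtain ⟨S, hS1, hS2⟩ := syl M r s k h1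
    have h3 : Del M r s (k + 1) = Del M r s k * S (r k) (s k) := by rw [← D_diag, hS1]
    rw [h3] at h2
    rw [hS2, hS1, hS1, hS1, h3]
    have h4 : S (r k) (s k) ≠ 0 := right_ne_zero_of_mul h2
    field_simp
    ring
  rw [Finset.sum_congr rfl hstep, Finset.sum_range_sub', h0]
  simp [D, Del, ext]

/-- Row operations. -/
lemma abs_det_eq {k : ℕ} (N B : Matrix (Fin k) (Fin k) ℝ) (c : ℕ → ℕ → ℝ)
    (hc : ∀ j, |c j j| = 1)
    (h : ∀ i j : Fin k, N i j.rev = ∑ q ∈ Finset.univ.filter (fun q : Fin k => q ≤ j),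
      c j q * B i q) : |N.det| = |B.det| := by
  let L : Matrix (Fin k) (Fin k) ℝ := of fun j q => if q ≤ j then c j q else 0
  have hL : |L.det| = 1 := by
    rw [det_of_lowerTriangular L]
    · rw [Finset.abs_prod]
      simp [L, hc]
    · intro i j hij
      have : i < j := hij
      simp [L, this]
  have hN : N.submatrix id Fin.revPerm = B * Lᵀ := by
    ext i j
    simp only [submatrix_apply, id, Fin.revPerm_apply, h, mul_apply, transpose_apply, L, of_apply]
    rw [Finset.sum_filter]
    refine Finset.sum_congr rfl fun q _ => ?_
    split_ifs <;> ring
  have := congrArg det hN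
  rw [det_permute', det_mul, det_transpose] at this
  have h2 := congrArg abs this
  rw [abs_mul, abs_mul, hL, mul_one] at h2
  rw [← h2]
  rcases Int.units_eq_one_or (Equiv.Perm.sign (Fin.revPerm (n := k))) with h | h <;> simp [h]

end CrossDec


namespace CrossDec

open Equiv

lemma perm_inv {k : ℕ} {σ : Perm (Fin k)} (h : σ ≠ 1) : ∃ i j, i < j ∧ σ j < σ i := by
  by_contra hc
  push Not at hc
  apply h
  have hm : StrictMono σ := fun i j hij =>
    lt_of_le_of_ne (hc i j hij) (fun he => hij.ne (σ.injective he))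
  have : (σ : Fin k → Fin k) = id := (hm.range_inj strictMono_id).1 (by simp [σ.surjective.range_eq])
  ext i
  simp [this]

/-- LGV with endpoints on a vertical line. -/
lemma lgv_vert (X : ℤ × ℤ → ℝ) {k : ℕ} (x y : Fin k → ℤ) (m : ℤ) (hx : StrictMono x)
    (hy : StrictAnti y) :
    TT X (fun i => (x i, (1 : ℤ))) (fun j => (m, y j)) =
      Matrix.det (Matrix.of fun i j => P X (x i, 1) (m, y j)) := by
  refine lgv X _ _ ?_
  intro σ hσ γ hγ
  obtain ⟨i, j, hij, hσij⟩ := perm_inv hσ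
  have h1 := up_le (hγ i)
  have h2 := up_le (hγ j)
  have h3 := hx hij
  have h4 := hy hσij
  dsimp only at h1 h2
  obtain ⟨w, hw1, hw2⟩ := cross (hγ i) (hγ j) (by dsimp only; omega) (by dsimp only; omega)
    (by dsimp only; omega) (by dsimp only; omega)
  exact ⟨w, (i, j), hij.ne, hw1, hw2⟩

/-- LGV with endpoints on a horizontal line. -/
lemma lgv_horiz (X : ℤ × ℤ → ℝ) {k : ℕ} (x y : Fin k → ℤ) (n : ℤ) (hx : StrictMono x)
    (hy : StrictMono y) :
    TT X (fun i => (x i, (1 : ℤ))) (fun j => (y j, n)) =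
      Matrix.det (Matrix.of fun i j => P X (x i, 1) (y j, n)) := by
  refine lgv X _ _ ?_
  intro σ hσ γ hγ
  obtain ⟨i, j, hij, hσij⟩ := perm_inv hσ
  have h1 := up_le (hγ i)
  have h2 := up_le (hγ j)
  have h3 := hx hij
  have h4 := hy hσij
  dsimp only at h1 h2
  obtain ⟨w, hw1, hw2⟩ := cross (hγ i) (hγ j) (by dsimp only; omega) (by dsimp only; omega)
    (by dsimp only; omega) (by dsimp only; omega)
  exact ⟨w, (i, j), hij.ne, hw1, hw2⟩

lemma wt_pos {X : ℤ × ℤ → ℝ} (hX : ∀ w, 0 < X w) (γ : List (ℤ × ℤ)) : 0 < wt X γ := by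
  unfold wt
  apply List.prod_pos
  intro a ha
  obtain ⟨w, -, rfl⟩ := List.mem_map.1 ha
  exact hX w

lemma TT_nonneg {X : ℤ × ℤ → ℝ} (hX : ∀ w, 0 < X w) {k : ℕ} (u v : Fin k → ℤ × ℤ) :
    0 ≤ TT X u v := by
  classical
  rw [TT_eq_sum]
  exact Finset.sum_nonneg fun γ _ => Finset.prod_nonneg fun l _ => (wt_pos hX _).le

lemma TT_pos {X : ℤ × ℤ → ℝ} (hX : ∀ w, 0 < X w) (m n : ℤ) {k : ℕ} (hk : (k : ℤ) ≤ m)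
    (hk' : (k : ℤ) ≤ n) :
    0 < TT X (fun i : Fin k => (((i : ℕ) : ℤ) + 1, (1 : ℤ))) (fun j : Fin k => (m, n - ((j : ℕ) : ℤ))) := by
  classical
  rw [TT_eq_sum]
  have hex : ∀ i : Fin k, ∃ γ, UP γ (((i : ℕ) : ℤ) + 1, (1 : ℤ)) (m, n - ((i : ℕ) : ℤ)) ∧
      ∀ w ∈ γ, (w.1 = ((i : ℕ) : ℤ) + 1 ∧ w.2 ≤ n - ((i : ℕ) : ℤ)) ∨
        (w.2 = n - ((i : ℕ) : ℤ) ∧ ((i : ℕ) : ℤ) + 1 ≤ w.1) := by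
    intro i
    have := i.2
    obtain ⟨γ, h1, h2⟩ := exists_lpath (n - (i : ℕ) - 1).toNat (m - (i : ℕ) - 1).toNat
      (((i : ℕ) : ℤ) + 1) 1
    have e1 : (((i : ℕ) : ℤ) + 1) + ((m - (i : ℕ) - 1).toNat : ℤ) = m := by omega
    have e2 : (1 : ℤ) + ((n - (i : ℕ) - 1).toNat : ℤ) = n - (i : ℕ) := by omega
    rw [e1, e2] at h1
    rw [e2] at h2
    exact ⟨γ, h1, h2⟩
  choose γ h1 h2 using hex
  refine Finset.sum_pos (fun γ _ => Finset.prod_pos fun l _ => wt_pos hX _) ⟨γ, ?_⟩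
  simp only [Finset.mem_filter, Fintype.mem_piFinset, mem_paths]
  refine ⟨h1, ?_⟩
  rintro ⟨w, ⟨p, q⟩, hpq, hp, hq⟩
  have hp' := h2 p w hp
  have hq' := h2 q w hq
  have : (p : ℕ) ≠ q := fun h => hpq (Fin.ext h)
  omega

/-- Expansion of the one-path functions along the top row in terms of the last column. -/
lemma expand (X : ℤ × ℤ → ℝ) (hX : ∀ w, 0 < X w) (x : ℤ) (p : ℕ) : ∀ y : ℤ, (p : ℤ) + 1 ≤ y →
    ∃ c : ℕ → ℝ, |c p| = 1 ∧ ∀ i : ℤ, P X (i, 1) (x - p, y) =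
      ∑ q ∈ Finset.range (p + 1), c q * P X (i, 1) (x, y - q) := by
  induction p with
  | zero => intro y hy; exact ⟨fun _ => 1, by simp, by simp⟩
  | succ p ih =>
    intro y hy
    push_cast at hy
    obtain ⟨c, hc1, hc2⟩ := ih y (by omega)
    obtain ⟨d, hd1, hd2⟩ := ih (y - 1) (by omega)
    refine ⟨fun q => (if q ≤ p then c q / X (x - p, y) else 0) - (if q = 0 then 0 else d (q - 1)),
      by simp [hd1], ?_⟩
    intro i
    have hrec := P_rec X (i, 1) (x - p, y).1 (x - p, y).2 (by simp; omega)
    dsimp only at hrec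
    have hne := (hX (x - p, y)).ne'
    have h1 : P X (i, 1) (x - (p + 1 : ℕ), y) =
        P X (i, 1) (x - p, y) / X (x - p, y) - P X (i, 1) (x - p, y - 1) := by
      rw [hrec]
      field_simp
      push_cast
      rw [show x - ((p : ℤ) + 1) = x - p - 1 by ring]
      ring
    rw [h1, hc2, hd2]
    simp only [sub_mul, Finset.sum_sub_distrib]
    congr 1
    · rw [Finset.sum_range_succ _ (p + 1)]
      simp only [add_le_iff_nonpos_right, nonpos_iff_eq_zero, one_ne_zero, if_false, zero_mul,
        add_zero]
      rw [Finset.sum_div]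
      refine Finset.sum_congr rfl fun q hq => ?_
      rw [Finset.mem_range] at hq
      rw [if_pos (by omega)]
      ring
    · rw [Finset.sum_range_succ' _ (p + 1)]
      simp only [if_true, zero_mul, add_zero]
      refine Finset.sum_congr rfl fun q hq => ?_
      simp only [Nat.add_eq_zero_iff, one_ne_zero, and_false, if_false, Nat.add_sub_cancel]
      push_cast
      rw [show y - 1 - (q : ℤ) = y - (q + 1) by ring]

lemma Del_eq_TT (X : ℤ × ℤ → ℝ) (m n : ℤ) (k : ℕ) :
    Del (fun a c => P X (a, 1) (m, c)) (fun i => (i : ℤ) + 1) (fun j => n - (j : ℤ)) k =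
    TT X (fun i : Fin k => (((i : ℕ) : ℤ) + 1, (1 : ℤ))) (fun j : Fin k => (m, n - ((j : ℕ) : ℤ))) := by
  rw [lgv_vert X (fun i : Fin k => ((i : ℕ) : ℤ) + 1) (fun j : Fin k => n - ((j : ℕ) : ℤ)) m]
  · rfl
  · intro i j h
    have : (i : ℕ) < j := h
    dsimp only; omega
  · intro i j h
    have : (i : ℕ) < j := h
    dsimp only; omega

lemma Tk_eq (X : ℤ × ℤ → ℝ) (hX : ∀ w, 0 < X w) (m n : ℤ) (k : ℕ) (hn : (k : ℤ) ≤ n) :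
    Tk X k (1, 1) (m, n) =
      Del (fun a c => P X (a, 1) (m, c)) (fun i => (i : ℤ) + 1) (fun j => n - (j : ℤ)) k := by
  rcases Nat.eq_zero_or_pos k with rfl | hk
  · simp [Tk, Del]
  have h1 : 0 ≤ Tk X k (1, 1) (m, n) := by
    rw [Tk, if_neg hk.ne']; exact TT_nonneg hX _ _
  have h2 : 0 ≤ Del (fun a c => P X (a, 1) (m, c)) (fun i => (i : ℤ) + 1)
      (fun j => n - (j : ℤ)) k := by
    rw [Del_eq_TT]; exact TT_nonneg hX _ _
  rw [← abs_of_nonneg h1, ← abs_of_nonneg h2, Tk, if_neg hk.ne',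
    lgv_horiz X (fun i : Fin k => (1 : ℤ) + (i : ℕ))
      (fun j : Fin k => m + (j : ℕ) - (k - 1 : ℤ)) n]
  · have hc : ∀ p : ℕ, ∃ c : ℕ → ℝ, |c p| = 1 ∧ ((p : ℤ) + 1 ≤ n → ∀ i : ℤ,
        P X (i, 1) (m - p, n) = ∑ q ∈ Finset.range (p + 1), c q * P X (i, 1) (m, n - q)) := by
      intro p
      by_cases hp : (p : ℤ) + 1 ≤ n
      · obtain ⟨c, h1, h2⟩ := expand X hX m p n hp
        exact ⟨c, h1, fun _ => h2⟩
      · exact ⟨fun _ => 1, by simp, fun h => absurd h hp⟩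
    choose c hc1 hc2 using hc
    refine abs_det_eq _ _ c hc1 ?_
    intro i j
    have hj := j.2
    have hr : ((j.rev : ℕ) : ℤ) = k - 1 - (j : ℕ) := by
      rw [Fin.val_rev]; omega
    simp only [Matrix.of_apply]
    rw [hr, show m + ((k : ℤ) - 1 - (j : ℕ)) - (k - 1) = m - (j : ℕ) by ring,
      hc2 j (by omega), add_comm (1 : ℤ)]
    symm
    refine Finset.sum_bij (fun q _ => (q : ℕ)) ?_ ?_ ?_ ?_
    · intro q hq
      simp only [Finset.mem_filter, Finset.mem_univ, true_and, Fin.le_def] at hq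
      rw [Finset.mem_range]; omega
    · intro a _ b _ h
      exact Fin.ext h
    · intro q hq
      rw [Finset.mem_range] at hq
      refine ⟨⟨q, by omega⟩, ?_, rfl⟩
      simp only [Finset.mem_filter, Finset.mem_univ, true_and, Fin.le_def]
      omega
    · intro q _
      rfl
  · intro i j h
    have : (i : ℕ) < j := h
    dsimp only; omega
  · intro i j h
    have : (i : ℕ) < j := h
    dsimp only; omega

lemma T1_eq (X : ℤ × ℤ → ℝ) (a m b : ℤ) : T1 X (a, 1) (m, b) = P X (a, 1) (m, b) := by
  unfold T1
  rw [lgv_vert X (fun _ : Fin 1 => a) (fun _ : Fin 1 => b) m (Subsingleton.strictMono _)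
    (Subsingleton.strictAnti _)]
  simp

lemma D_eq (X : ℤ × ℤ → ℝ) (m n : ℤ) (k : ℕ) (a c : ℤ) (ha : (k : ℤ) + 1 ≤ a)
    (hc : c ≤ n - (k : ℤ)) :
    D (fun a c => P X (a, 1) (m, c)) (fun i => (i : ℤ) + 1) (fun j => n - (j : ℤ)) k a c =
    TT X (fun i : Fin (k + 1) => (ext (fun i => (i : ℤ) + 1) k a i, (1 : ℤ)))
      (fun j : Fin (k + 1) => (m, ext (fun j => n - (j : ℤ)) k c j)) := by
  rw [lgv_vert X (fun i : Fin (k + 1) => ext (fun i => (i : ℤ) + 1) k a i)]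
  · rfl
  · intro i j h
    have h1 : (i : ℕ) < j := h
    have h2 := j.2
    have h3 : (i : ℕ) ≠ k := by omega
    simp only [ext, if_neg h3]
    split_ifs <;> omega
  · intro i j h
    have h1 : (i : ℕ) < j := h
    have h2 := j.2
    have h3 : (i : ℕ) ≠ k := by omega
    simp only [ext, if_neg h3]
    split_ifs <;> omega

lemma ext_self (r : ℕ → ℤ) (k : ℕ) (i : ℕ) : ext r k (r k) i = r i := by
  unfold ext; split_ifs with h <;> simp [h]

end CrossDec

theorem one_path_crossing_decomposition (X : ℤ × ℤ → ℝ) (hX : ∀ w, 0 < X w)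
    (m n : ℤ) (hm : 1 ≤ m) (hn : 1 ≤ n) (a b : ℤ)
    (ha1 : 1 ≤ a) (ham : a ≤ m) (hb1 : 1 ≤ b) (hbn : b ≤ n) :
    T1 X (a, (1 : ℤ)) (m, b) =
      ∑ k ∈ Finset.Icc (1 : ℤ) (min a (n - b + 1)),
        TT X (startList a k.toNat) (topList m n k.toNat) *
          TT X (botList k.toNat) (endList m n b k.toNat) /
          (Tk X k.toNat (1, 1) (m, n) * Tk X (k - 1).toNat (1, 1) (m, n)) := by
  set K := min a (n - b + 1) with hK
  have hKa : K ≤ a := min_le_left _ _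
  have hKb : K ≤ n - b + 1 := min_le_right _ _
  have hK1 : 1 ≤ K := le_min ha1 (by omega)
  have hlu := CrossDec.lu (fun a c => CrossDec.P X (a, 1) (m, c)) (fun i => (i : ℤ) + 1)
    (fun j => n - (j : ℤ)) K.toNat a b
    (by
      intro k hk
      rw [CrossDec.Del_eq_TT]
      exact (CrossDec.TT_pos hX m n (by omega) (by omega)).ne')
    (by
      rcases min_choice a (n - b + 1) with h | h
      · have := CrossDec.D_row (fun a c => CrossDec.P X (a, 1) (m, c)) (fun i => (i : ℤ) + 1)
          (fun j => n - (j : ℤ)) K.toNat b (a - 1).toNat (by omega)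
        rwa [show (((a - 1).toNat : ℕ) : ℤ) + 1 = a by omega] at this
      · have := CrossDec.D_col (fun a c => CrossDec.P X (a, 1) (m, c)) (fun i => (i : ℤ) + 1)
          (fun j => n - (j : ℤ)) K.toNat a (n - b).toNat (by omega)
        rwa [show n - (((n - b).toNat : ℕ) : ℤ) = b by omega] at this)
  rw [CrossDec.T1_eq]
  refine hlu.trans ?_
  refine Finset.sum_bij' (fun k _ => (k : ℤ) + 1) (fun k _ => (k - 1).toNat) ?_ ?_ ?_ ?_ ?_
  · intro k hk
    rw [Finset.mem_range] at hk
    rw [Finset.mem_Icc]; omega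
  · intro k hk
    rw [Finset.mem_Icc] at hk
    rw [Finset.mem_range]; omega
  · intro k hk
    simp
  · intro k hk
    rw [Finset.mem_Icc] at hk
    omega
  · intro k hk
    rw [Finset.mem_range] at hk
    have e1 : ((k : ℤ) + 1).toNat = k + 1 := by omega
    have e2 : ((k : ℤ) + 1 - 1).toNat = k := by omega
    rw [e1, e2, CrossDec.Tk_eq X hX m n (k + 1) (by push_cast; omega),
      CrossDec.Tk_eq X hX m n k (by omega), CrossDec.D_eq X m n k a _ (by omega) le_rfl,
      CrossDec.D_eq X m n k _ b le_rfl (by omega)]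
    have s1 : (fun i : Fin (k + 1) => (CrossDec.ext (fun i => (i : ℤ) + 1) k a i, (1 : ℤ))) =
        startList a (k + 1) := by
      funext i
      simp only [CrossDec.ext, startList, Nat.add_right_cancel_iff]
      split_ifs <;> rfl
    have s2 : (fun j : Fin (k + 1) => (m, CrossDec.ext (fun j => n - (j : ℤ)) k b j)) =
        endList m n b (k + 1) := by
      funext i
      simp only [CrossDec.ext, endList, Nat.add_right_cancel_iff]
      split_ifs <;> rfl
    have s3 : (fun i : Fin (k + 1) =>
        (CrossDec.ext (fun i => (i : ℤ) + 1) k ((k : ℤ) + 1) i, (1 : ℤ))) = botList (k + 1) := by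
      funext i
      have := CrossDec.ext_self (fun i => (i : ℤ) + 1) k i
      rw [this]
      rfl
    have s4 : (fun j : Fin (k + 1) =>
        (m, CrossDec.ext (fun j => n - (j : ℤ)) k (n - (k : ℤ)) j)) = topList m n (k + 1) := by
      funext i
      have := CrossDec.ext_self (fun j => n - (j : ℤ)) k i
      rw [this]
      rfl
    rw [s1, s2, s3, s4]
end

section
/- Let X : ℤ² → (0,∞) be strictly positive vertex weights, m,n ≥ 1, and integers 1 ≤ j ≤ a ≤ m and 1 ≤ b ≤ n−j+1. Then T([(1,1)^{j−1},(a,1)],[(m,n)^{j−1},(m,b)]) / T_{j−1}((1,1),(m,n)) = Σ_{k=j}^{min(a, n−b+1)} T([(1,1)^{k−1},(a,1)],[(m,n)^k]) · T([(1,1)^k],[(m,n)^{k−1},(m,b)]) / ( T_k((1,1),(m,n)) · T_{k−1}((1,1),(m,n)) ), where [(1,1)^{k−1},(a,1)] denotes the list (1,1),(2,1),…,(k−1,1),(a,1) and [(m,n)^{k−1},(m,b)] the list (m,n),(m,n−1),…,(m,n−k+2),(m,b). -/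
open scoped BigOperators

lemma cd_upStep_iff (p q : ℤ × ℤ) :
    UpStep p q ↔ q = (p.1 + 1, p.2) ∨ q = (p.1, p.2 + 1) := by
  simp [UpStep, Prod.ext_iff]

lemma cd_path_singleton (u : ℤ × ℤ) : IsDirPath UpStep [u] u u := by
  simp [IsDirPath, List.Chain']

lemma cd_path_cons {γ : List (ℤ × ℤ)} {u u' v : ℤ × ℤ} (h : UpStep u u')
    (hγ : IsDirPath UpStep γ u' v) : IsDirPath UpStep (u :: γ) u v := by
  cases γ with
  | nil => simp [IsDirPath] at hγ
  | cons a l =>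
    obtain ⟨h1, h2, h3⟩ := hγ
    simp at h1
    subst h1
    refine ⟨rfl, ?_, ?_⟩
    · rw [List.getLast?_cons_cons]; exact h2
    · exact List.IsChain.cons_cons h h3

lemma cd_path_cases {γ : List (ℤ × ℤ)} {u v : ℤ × ℤ} (hγ : IsDirPath UpStep γ u v) :
    (γ = [u] ∧ u = v) ∨ ∃ γ' u', γ = u :: γ' ∧ UpStep u u' ∧ IsDirPath UpStep γ' u' v := by
  obtain ⟨h1, h2, h3⟩ := hγ
  cases γ with
  | nil => simp at h1
  | cons a l =>
    simp at h1
    subst h1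
    cases l with
    | nil => left; simp at h2; exact ⟨rfl, h2⟩
    | cons c l =>
      right
      refine ⟨c :: l, c, rfl, ?_, rfl, ?_, ?_⟩
      · cases h3 with
        | cons_cons h _ => exact h
      · rw [List.getLast?_cons_cons] at h2; exact h2
      · cases h3 with
        | cons_cons _ h => exact h

lemma cd_head_mem {γ : List (ℤ × ℤ)} {u v : ℤ × ℤ} (hγ : IsDirPath UpStep γ u v) : u ∈ γ := by
  exact List.mem_of_mem_head? hγ.1

lemma cd_last_mem {γ : List (ℤ × ℤ)} {u v : ℤ × ℤ} (hγ : IsDirPath UpStep γ u v) : v ∈ γ := by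
  exact List.mem_of_mem_getLast? hγ.2.1

lemma cd_path_bounds {γ : List (ℤ × ℤ)} : ∀ {u v : ℤ × ℤ}, IsDirPath UpStep γ u v →
    ∀ w ∈ γ, u ≤ w ∧ w ≤ v := by
  induction γ with
  | nil => intro u v h w hw; simp at hw
  | cons a l ih =>
    intro u v h w hw
    rcases cd_path_cases h with ⟨h1, h2⟩ | ⟨γ', u', h1, h2, h3⟩
    · rw [h1] at hw
      simp at hw
      subst hw
      subst h2
      exact ⟨le_rfl, le_rfl⟩
    · simp only [List.cons.injEq] at h1
      obtain ⟨rfl, rfl⟩ := h1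
      have huu : a ≤ u' := by
        rw [cd_upStep_iff] at h2
        rcases h2 with h2 | h2 <;> subst h2 <;> simp [Prod.le_def]
      rcases List.mem_cons.1 hw with rfl | hw
      · exact ⟨le_rfl, huu.trans (ih h3 u' (cd_head_mem h3)).2⟩
      · exact ⟨huu.trans (ih h3 w hw).1, (ih h3 w hw).2⟩

lemma cd_path_le {γ : List (ℤ × ℤ)} {u v : ℤ × ℤ} (hγ : IsDirPath UpStep γ u v) : u ≤ v :=
  (cd_path_bounds hγ u (cd_head_mem hγ)).2

lemma cd_path_self {γ : List (ℤ × ℤ)} {u : ℤ × ℤ} (hγ : IsDirPath UpStep γ u u) : γ = [u] := by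
  rcases cd_path_cases hγ with h | ⟨γ', u', h1, h2, h3⟩
  · exact h.1
  · exfalso
    have h4 := cd_path_le h3
    rw [cd_upStep_iff] at h2
    rcases h2 with h2 | h2 <;> subst h2 <;> simp [Prod.le_def] at h4

lemma cd_paths_finite (v : ℤ × ℤ) (N : ℕ) : ∀ u : ℤ × ℤ, (v.1 + v.2 - u.1 - u.2 + 1).toNat ≤ N →
    {γ | IsDirPath UpStep γ u v}.Finite := by
  induction N with
  | zero =>
    intro u hu
    convert Set.finite_empty
    ext γ
    simp only [Set.mem_setOf_eq, Set.mem_empty_iff_false, iff_false]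
    intro h
    have := cd_path_le h
    rw [Prod.le_def] at this
    omega
  | succ N ih =>
    intro u hu
    by_cases h0 : v.1 + v.2 - u.1 - u.2 + 1 ≤ 0
    · exact ih u (by omega)
    have h1 := ih (u.1 + 1, u.2) (by dsimp only; omega)
    have h2 := ih (u.1, u.2 + 1) (by dsimp only; omega)
    refine (((Set.finite_singleton [u]).union (h1.image (List.cons u))).union
      (h2.image (List.cons u))).subset ?_
    intro γ hγ
    rcases cd_path_cases hγ with h | ⟨γ', u', h1, h2, h3⟩
    · left; left; exact h.1
    · rw [cd_upStep_iff] at h2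
      rcases h2 with h2 | h2 <;> subst h2
      · left; right; exact ⟨γ', h3, h1.symm⟩
      · right; exact ⟨γ', h3, h1.symm⟩

lemma cd_tuples_finite {k : ℕ} (u v : Fin k → ℤ × ℤ) :
    (DisjointPathTuples UpStep u v).Finite := by
  refine (Set.Finite.pi' (fun i => cd_paths_finite (v i) _ (u i) le_rfl)).subset ?_
  intro γ hγ i
  exact hγ.1 i

lemma cd_TT_eq_sum (X : ℤ × ℤ → ℝ) {k : ℕ} (u v : Fin k → ℤ × ℤ) :
    TT X u v = ∑ γ ∈ (cd_tuples_finite u v).toFinset, tupleWeight X γ := by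
  unfold TT dirPF
  rw [← Finset.tsum_subtype]
  have : (DisjointPathTuples UpStep u v) =
    {x | x ∈ (cd_tuples_finite u v).toFinset} := by ext; simp
  conv_lhs => rw [this]
  rfl

lemma cd_TT_zero_of_empty (X : ℤ × ℤ → ℝ) {k : ℕ} (u v : Fin k → ℤ × ℤ)
    (h : ∀ γ, γ ∉ DisjointPathTuples UpStep u v) : TT X u v = 0 := by
  rw [cd_TT_eq_sum]
  apply Finset.sum_eq_zero
  intro γ hγ
  simp only [Set.Finite.mem_toFinset] at hγ
  exact absurd hγ (h γ)

lemma cd_TT_zero_not_le (X : ℤ × ℤ → ℝ) {k : ℕ} (u v : Fin k → ℤ × ℤ) (i : Fin k)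
    (h : ¬ u i ≤ v i) : TT X u v = 0 :=
  cd_TT_zero_of_empty X u v fun _ hγ => h (cd_path_le (hγ.1 i))

lemma cd_TT_zero_coll (X : ℤ × ℤ → ℝ) {k : ℕ} (u v : Fin k → ℤ × ℤ) (i l : Fin k)
    (hil : i ≠ l) (h : u i = u l) : TT X u v = 0 :=
  cd_TT_zero_of_empty X u v fun _ hγ =>
    hγ.2 i l hil (u i) (cd_head_mem (hγ.1 i)) (h ▸ cd_head_mem (hγ.1 l))

lemma cd_TT_fin_zero (X : ℤ × ℤ → ℝ) (u v : Fin 0 → ℤ × ℤ) : TT X u v = 1 := by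
  rw [cd_TT_eq_sum]
  have : (cd_tuples_finite u v).toFinset = Finset.univ := by
    ext γ; simp [DisjointPathTuples]
  rw [this]
  simp [tupleWeight]

lemma cd_weight_step (X : ℤ × ℤ → ℝ) {k : ℕ} (γ : Fin k → List (ℤ × ℤ)) (i : Fin k) (p : ℤ × ℤ)
    (hp : ∀ l, p ∉ γ l) :
    tupleWeight X (Function.update γ i (p :: γ i)) = X p * tupleWeight X γ := by
  unfold tupleWeight
  rw [← Finset.prod_insert (s := Finset.univ.biUnion fun i => (γ i).toFinset)]
  · congr 1
    ext w
    simp only [Finset.mem_biUnion, Finset.mem_univ, List.mem_toFinset, true_and,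
      Finset.mem_insert]
    constructor
    · rintro ⟨l, hl⟩
      by_cases h : l = i
      · subst h
        simp at hl
        rcases hl with hl | hl
        · exact Or.inl hl
        · exact Or.inr ⟨l, hl⟩
      · rw [Function.update_of_ne h] at hl
        exact Or.inr ⟨l, hl⟩
    · rintro (rfl | ⟨l, hl⟩)
      · exact ⟨i, by simp⟩
      · by_cases h : l = i
        · subst h
          exact ⟨l, by simp [hl]⟩
        · exact ⟨l, by rw [Function.update_of_ne h]; exact hl⟩
  · simpa using hp

/-- First-step decomposition at a source not reachable from the other sources. -/
lemma cd_TT_step (X : ℤ × ℤ → ℝ) {k : ℕ} (u v : Fin k → ℤ × ℤ) (i : Fin k)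
    (hne : u i ≠ v i) (hmin : ∀ l, l ≠ i → ¬ u l ≤ u i) :
    TT X u v = X (u i) * (TT X (Function.update u i ((u i).1 + 1, (u i).2)) v +
      TT X (Function.update u i ((u i).1, (u i).2 + 1)) v) := by
  classical
  set Φ : (Fin k → List (ℤ × ℤ)) → (Fin k → List (ℤ × ℤ)) :=
    fun γ => Function.update γ i (u i :: γ i) with hΦ
  have hinj : Function.Injective Φ := by
    intro γ γ' h
    funext l
    have := congrFun h l
    by_cases hl : l = i
    · subst hl; simpa [hΦ] using this
    · simpa [hΦ, Function.update_of_ne hl] using this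
  -- the removed vertex is not visited
  have hnot : ∀ p, UpStep (u i) p → ∀ γ ∈ DisjointPathTuples UpStep (Function.update u i p) v,
      ∀ l, u i ∉ γ l := by
    intro p hp γ hγ l hl
    have hb := (cd_path_bounds (hγ.1 l) _ hl).1
    by_cases h : l = i
    · subst h
      rw [Function.update_self] at hb
      rw [cd_upStep_iff] at hp
      rcases hp with hp | hp <;> subst hp <;> simp [Prod.le_def] at hb
    · rw [Function.update_of_ne h] at hb
      exact hmin l h hb
  have hmem : ∀ p, UpStep (u i) p → ∀ γ ∈ DisjointPathTuples UpStep (Function.update u i p) v,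
      Φ γ ∈ DisjointPathTuples UpStep u v := by
    intro p hp γ hγ
    have hn := hnot p hp γ hγ
    refine ⟨?_, ?_⟩
    · intro l
      have h1 := hγ.1 l
      by_cases h : l = i
      · subst h
        rw [Function.update_self] at h1
        simpa [hΦ] using cd_path_cons hp h1
      · rw [Function.update_of_ne h] at h1
        simpa [hΦ, Function.update_of_ne h] using h1
    · intro l l' hll w hw hw'
      by_cases h : l = i
      · have h' : l' ≠ i := fun e => hll (h.trans e.symm)
        subst h
        simp only [hΦ, Function.update_self, Function.update_of_ne h', List.mem_cons] at hw hw'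
        rcases hw with rfl | hw
        · exact hn _ hw'
        · exact hγ.2 _ _ hll w hw hw'
      · by_cases h' : l' = i
        · subst h'
          simp only [hΦ, Function.update_self, Function.update_of_ne h, List.mem_cons] at hw hw'
          rcases hw' with rfl | hw'
          · exact hn _ hw
          · exact hγ.2 _ _ hll w hw hw'
        · simp only [hΦ, Function.update_of_ne h, Function.update_of_ne h'] at hw hw'
          exact hγ.2 _ _ hll w hw hw'
  have hs1 : UpStep (u i) ((u i).1 + 1, (u i).2) := Or.inl ⟨rfl, rfl⟩
  have hs2 : UpStep (u i) ((u i).1, (u i).2 + 1) := Or.inr ⟨rfl, rfl⟩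
  set u1 := Function.update u i ((u i).1 + 1, (u i).2) with hu1
  set u2 := Function.update u i ((u i).1, (u i).2 + 1) with hu2
  have hset : (cd_tuples_finite u v).toFinset =
      (cd_tuples_finite u1 v).toFinset.image Φ ∪ (cd_tuples_finite u2 v).toFinset.image Φ := by
    ext γ
    simp only [Set.Finite.mem_toFinset, Finset.mem_union, Finset.mem_image]
    constructor
    · intro hγ
      rcases cd_path_cases (hγ.1 i) with h | ⟨γ', u', h1, h2, h3⟩
      · exact absurd h.2 hne
      · have key : Function.update γ i γ' ∈
            DisjointPathTuples UpStep (Function.update u i u') v := by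
          refine ⟨?_, ?_⟩
          · intro l
            by_cases h : l = i
            · subst h; simpa using h3
            · simpa [Function.update_of_ne h] using hγ.1 l
          · have hsub : ∀ l w, w ∈ Function.update γ i γ' l → w ∈ γ l := by
              intro l w hw
              by_cases h : l = i
              · subst h
                rw [Function.update_self] at hw
                rw [h1]; exact List.mem_cons_of_mem _ hw
              · rwa [Function.update_of_ne h] at hw
            intro l l' hll w hw hw'
            exact hγ.2 l l' hll w (hsub _ _ hw) (hsub _ _ hw')
        have hΦk : Φ (Function.update γ i γ') = γ := by
          simp only [hΦ, Function.update_self, Function.update_idem]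
          rw [← h1, Function.update_eq_self]
        rw [cd_upStep_iff] at h2
        rcases h2 with h2 | h2 <;> subst h2
        · exact Or.inl ⟨_, key, hΦk⟩
        · exact Or.inr ⟨_, key, hΦk⟩
    · rintro (⟨γ', h1, rfl⟩ | ⟨γ', h1, rfl⟩)
      · exact hmem _ hs1 _ h1
      · exact hmem _ hs2 _ h1
  have hdisj : Disjoint ((cd_tuples_finite u1 v).toFinset.image Φ)
      ((cd_tuples_finite u2 v).toFinset.image Φ) := by
    rw [Finset.disjoint_left]
    intro γ h1 h2
    simp only [Set.Finite.mem_toFinset, Finset.mem_image] at h1 h2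
    obtain ⟨γ1, hγ1, rfl⟩ := h1
    obtain ⟨γ2, hγ2, h⟩ := h2
    have := hinj h
    subst this
    have e1 := (hγ1.1 i).1
    have e2 := (hγ2.1 i).1
    rw [e1, hu1, hu2] at e2
    simp at e2
  rw [cd_TT_eq_sum, hset, Finset.sum_union hdisj, Finset.sum_image (fun _ _ _ _ h => hinj h),
    Finset.sum_image (fun _ _ _ _ h => hinj h), mul_add, cd_TT_eq_sum X u1, cd_TT_eq_sum X u2,
    Finset.mul_sum, Finset.mul_sum]
  congr 1
  · apply Finset.sum_congr rfl
    intro γ hγ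
    rw [Set.Finite.mem_toFinset] at hγ
    exact cd_weight_step X γ i _ (hnot _ hs1 γ hγ)
  · apply Finset.sum_congr rfl
    intro γ hγ
    rw [Set.Finite.mem_toFinset] at hγ
    exact cd_weight_step X γ i _ (hnot _ hs2 γ hγ)

lemma cd_TT_dead (X : ℤ × ℤ → ℝ) {k : ℕ} (u v : Fin (k + 1) → ℤ × ℤ)
    (he : u (Fin.last k) = v (Fin.last k))
    (hmin : ∀ l : Fin k, ¬ u l.castSucc ≤ u (Fin.last k)) :
    TT X u v = X (u (Fin.last k)) *
      TT X (fun l : Fin k => u l.castSucc) (fun l : Fin k => v l.castSucc) := by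
  classical
  set p := u (Fin.last k) with hp
  set Φ : (Fin k → List (ℤ × ℤ)) → (Fin (k + 1) → List (ℤ × ℤ)) :=
    fun γ => Fin.snoc (α := fun _ => List (ℤ × ℤ)) γ [p] with hΦ
  have hΦc : ∀ γ (l : Fin k), Φ γ l.castSucc = γ l := fun γ l => by simp [hΦ]
  have hΦl : ∀ γ, Φ γ (Fin.last k) = [p] := fun γ => by simp [hΦ]
  have hinj : Function.Injective Φ := by
    intro γ γ' h
    funext l
    rw [← hΦc γ, h, hΦc]
  have hnot : ∀ γ ∈ DisjointPathTuples UpStep (fun l : Fin k => u l.castSucc)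
      (fun l : Fin k => v l.castSucc), ∀ l, p ∉ γ l := by
    intro γ hγ l hl
    exact hmin l (cd_path_bounds (hγ.1 l) _ hl).1
  have hset : (cd_tuples_finite u v).toFinset =
      (cd_tuples_finite (fun l : Fin k => u l.castSucc)
        (fun l : Fin k => v l.castSucc)).toFinset.image Φ := by
    ext γ
    simp only [Set.Finite.mem_toFinset, Finset.mem_image]
    constructor
    · intro hγ
      refine ⟨fun l => γ l.castSucc, ⟨fun l => hγ.1 _, fun i j hij w hw hw' =>
        hγ.2 _ _ (fun h => hij (Fin.castSucc_injective _ h)) w hw hw'⟩, ?_⟩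
      funext l
      refine Fin.lastCases ?_ (fun l => ?_) l
      · rw [hΦl]
        have := hγ.1 (Fin.last k)
        rw [← he, ← hp] at this
        exact (cd_path_self this).symm
      · rw [hΦc]
    · rintro ⟨γ, hγ, rfl⟩
      refine ⟨?_, ?_⟩
      · intro l
        refine Fin.lastCases ?_ (fun l => ?_) l
        · rw [hΦl, ← he, ← hp]; exact cd_path_singleton p
        · rw [hΦc]; exact hγ.1 l
      · intro i j
        refine Fin.lastCases ?_ (fun i => ?_) i
        · refine Fin.lastCases ?_ (fun j => ?_) j
          · intro h; exact absurd rfl h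
          · intro _ w hw hw'
            rw [hΦl, List.mem_singleton] at hw
            rw [hΦc] at hw'
            subst hw
            exact hnot γ hγ j hw'
        · refine Fin.lastCases ?_ (fun j => ?_) j
          · intro _ w hw hw'
            rw [hΦl, List.mem_singleton] at hw'
            rw [hΦc] at hw
            subst hw'
            exact hnot γ hγ i hw
          · intro hij w hw hw'
            rw [hΦc] at hw hw'
            exact hγ.2 i j (fun h => hij (by rw [h])) w hw hw'
  rw [cd_TT_eq_sum, hset, Finset.sum_image (fun _ _ _ _ h => hinj h), cd_TT_eq_sum,
    Finset.mul_sum]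
  apply Finset.sum_congr rfl
  intro γ hγ
  rw [Set.Finite.mem_toFinset] at hγ
  unfold tupleWeight
  rw [← Finset.prod_insert (s := Finset.univ.biUnion fun i => (γ i).toFinset)]
  · congr 1
    ext w
    simp only [Finset.mem_biUnion, Finset.mem_univ, List.mem_toFinset, true_and,
      Finset.mem_insert]
    constructor
    · rintro ⟨l, hl⟩
      revert hl
      refine Fin.lastCases ?_ (fun l => ?_) l
      · rw [hΦl, List.mem_singleton]; exact Or.inl
      · rw [hΦc]; exact fun h => Or.inr ⟨l, h⟩
    · rintro (rfl | ⟨l, hl⟩)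
      · exact ⟨Fin.last k, by rw [hΦl]; simp⟩
      · exact ⟨l.castSucc, by rw [hΦc]; exact hl⟩
  · simpa using hnot γ hγ

lemma cd_T1_self (X : ℤ × ℤ → ℝ) (v : ℤ × ℤ) : T1 X v v = X v := by
  unfold T1
  rw [cd_TT_dead X (k := 0) _ _ rfl (fun l => l.elim0), cd_TT_fin_zero, mul_one]

lemma cd_T1_zero (X : ℤ × ℤ → ℝ) (u v : ℤ × ℤ) (h : ¬ u ≤ v) : T1 X u v = 0 :=
  cd_TT_zero_not_le X _ _ 0 h

lemma cd_T1_step (X : ℤ × ℤ → ℝ) (u v : ℤ × ℤ) (h : u ≠ v) :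
    T1 X u v = X u * (T1 X (u.1 + 1, u.2) v + T1 X (u.1, u.2 + 1) v) := by
  unfold T1
  rw [cd_TT_step X (fun _ : Fin 1 => u) (fun _ => v) 0 h
    (fun l hl => absurd (Subsingleton.elim l 0) hl)]
  have : ∀ w : ℤ × ℤ, Function.update (fun _ : Fin 1 => u) 0 w = fun _ => w := by
    intro w; funext l; rw [Subsingleton.elim l 0, Function.update_self]
  rw [this, this]

/-- Lindström–Gessel–Viennot for sinks on a vertical line. -/
lemma cd_LGV (X : ℤ × ℤ → ℝ) (m : ℤ) (k : ℕ) : ∀ (y : Fin k → ℤ) (u : Fin k → ℤ × ℤ),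
    (∀ i l, i < l → y l < y i) →
    (∀ i l, i ≤ l → (u i).1 ≤ (u l).1 ∧ (u l).2 ≤ (u i).2) →
    TT X u (fun i => (m, y i)) = Matrix.det (Matrix.of fun i j => T1 X (u i) (m, y j)) := by
  induction k with
  | zero => intro y u _ _; rw [cd_TT_fin_zero]; simp
  | succ k ihk =>
    intro y u hy
    -- inner induction
    suffices H : ∀ (N : ℕ) (u : Fin (k + 1) → ℤ × ℤ),
        (∑ i, (m + y (Fin.last k) + 1 - (u i).1 - (u i).2).toNat ≤ N) →
        (∀ i l, i ≤ l → (u i).1 ≤ (u l).1 ∧ (u l).2 ≤ (u i).2) →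
        TT X u (fun i => (m, y i)) =
          Matrix.det (Matrix.of fun i j => T1 X (u i) (m, y j)) from H _ u le_rfl
    intro N
    induction N with
    | zero =>
      intro u hN hu
      have h0 := hN
      rw [Nat.le_zero, Finset.sum_eq_zero_iff] at h0
      have h1 := h0 (Fin.last k) (Finset.mem_univ _)
      have h2 : ¬ u (Fin.last k) ≤ (m, y (Fin.last k)) := by
        rw [Prod.le_def]; dsimp only; omega
      rw [cd_TT_zero_not_le X _ _ (Fin.last k) h2]
      by_cases h3 : (u (Fin.last k)).2 ≤ y (Fin.last k)
      · symm
        apply Matrix.det_eq_zero_of_row_eq_zero (Fin.last k)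
        intro j
        apply cd_T1_zero
        rw [Prod.le_def] at h2 ⊢; dsimp only at h2 ⊢; omega
      · symm
        apply Matrix.det_eq_zero_of_column_eq_zero (Fin.last k)
        intro i
        apply cd_T1_zero
        have := hu i (Fin.last k) (Fin.le_last i)
        rw [Prod.le_def]; dsimp only; omega
    | succ N ihN =>
      intro u hN hu
      by_cases h3 : (u (Fin.last k)).2 ≤ y (Fin.last k)
      swap
      · rw [cd_TT_zero_not_le X _ _ (Fin.last k) (by rw [Prod.le_def]; dsimp only; omega)]
        symm
        apply Matrix.det_eq_zero_of_column_eq_zero (Fin.last k)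
        intro i
        apply cd_T1_zero
        have := hu i (Fin.last k) (Fin.le_last i)
        rw [Prod.le_def]; dsimp only; omega
      by_cases h4 : (u (Fin.last k)).1 ≤ m
      swap
      · rw [cd_TT_zero_not_le X _ _ (Fin.last k) (by rw [Prod.le_def]; dsimp only; omega)]
        symm
        apply Matrix.det_eq_zero_of_row_eq_zero (Fin.last k)
        intro j
        apply cd_T1_zero
        rw [Prod.le_def]; dsimp only; omega
      by_cases hinj : Function.Injective u
      swap
      · simp only [Function.Injective, not_forall] at hinj
        obtain ⟨i, l, h, hil⟩ := hinj
        rw [cd_TT_zero_coll X _ _ i l hil h]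
        symm
        apply Matrix.det_zero_of_row_eq hil
        funext j
        simp [h]
      obtain ⟨i, hi⟩ := Finite.exists_min (fun i => (u i).1 + (u i).2)
      have hne : ∀ l, l ≠ i → ¬ u l ≤ u i := by
        intro l hl hle
        rw [Prod.le_def] at hle
        have := hi l
        exact hl (hinj (Prod.ext (by omega) (by omega)))
      by_cases hd : u i = (m, y (Fin.last k))
      · -- dead case
        have hil : i = Fin.last k := by
          by_contra hc
          have h5 := hu i (Fin.last k) (Fin.le_last i)
          have h6 := hi (Fin.last k)
          have : u i = u (Fin.last k) := by
            rw [hd] at h5 h6 ⊢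
            dsimp only at h5 h6
            exact Prod.ext (by dsimp only; omega) (by dsimp only; omega)
          exact hc (hinj this)
        subst hil
        have hne' : ∀ l : Fin k, ¬ u l.castSucc ≤ u (Fin.last k) :=
          fun l => hne _ (Fin.castSucc_lt_last l).ne
        rw [cd_TT_dead X u _ hd hne', Matrix.det_succ_column _ (Fin.last k),
          Fin.sum_univ_castSucc, Finset.sum_eq_zero]
        · rw [ihk (fun l => y l.castSucc) (fun l => u l.castSucc)
            (fun i l h => hy _ _ (by simpa using h)) (fun i l h => hu _ _ (by simpa using h))]
          simp only [zero_add, Matrix.of_apply, Fin.val_last, Fin.succAbove_last]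
          rw [hd, cd_T1_self, Even.neg_one_pow ⟨k, rfl⟩, one_mul]
          rfl
        · intro l _
          simp only [Matrix.of_apply]
          rw [cd_T1_zero X _ _ (hd ▸ hne' l)]
          simp
      · have hxi : (u i).1 ≤ m := le_trans (hu i _ (Fin.le_last i)).1 h4
        have hnv : ∀ j, u i ≠ (m, y j) := by
          intro j hj
          by_cases hjl : j = Fin.last k
          · rw [hjl] at hj; exact hd hj
          have h7 := hy j (Fin.last k) (Fin.lt_last_iff_ne_last.2 hjl)
          have h6 := hi (Fin.last k)
          have : (u i).1 = m := by rw [hj]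
          have : (u i).2 = y j := by rw [hj]
          omega
        have hh : (u i).1 + (u i).2 ≤ m + y (Fin.last k) := by
          have := hi (Fin.last k); omega
        have hsum : ∀ w : ℤ × ℤ, w.1 + w.2 = (u i).1 + (u i).2 + 1 →
            ∑ l, (m + y (Fin.last k) + 1 - (Function.update u i w l).1 -
              (Function.update u i w l).2).toNat ≤ N := by
          intro w hw
          have : ∑ l, (m + y (Fin.last k) + 1 - (Function.update u i w l).1 -
              (Function.update u i w l).2).toNat <
              ∑ i, (m + y (Fin.last k) + 1 - (u i).1 - (u i).2).toNat := by
            apply Finset.sum_lt_sum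
            · intro l _
              by_cases hl : l = i
              · subst hl; rw [Function.update_self]; omega
              · rw [Function.update_of_ne hl]
            · exact ⟨i, Finset.mem_univ _, by rw [Function.update_self]; omega⟩
          omega
        have hst : ∀ i' l' : Fin (k + 1), i' ≤ l' → u i' ≠ u l' →
            ((u i').1 ≤ (u l').1 ∧ (u l').2 ≤ (u i').2) ∧
            ((u i').1 < (u l').1 ∨ (u l').2 < (u i').2) := by
          intro i' l' h h'
          refine ⟨hu _ _ h, ?_⟩
          by_contra hc
          have := hu _ _ h
          exact h' (Prod.ext (by omega) (by omega))
        have hCC : ∀ w : ℤ × ℤ, (w = ((u i).1 + 1, (u i).2) ∨ w = ((u i).1, (u i).2 + 1)) →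
            ∀ i' l', i' ≤ l' → (Function.update u i w i').1 ≤ (Function.update u i w l').1 ∧
              (Function.update u i w l').2 ≤ (Function.update u i w i').2 := by
          intro w hw i' l' hil
          by_cases h1 : i' = i
          · by_cases h2 : l' = i
            · subst h1; subst h2; simp
            · have h8 := hst i' l' hil (by rw [h1]; exact fun e => h2 (hinj e).symm)
              have h6 := hi l'
              rw [h1] at h8
              rw [h1, Function.update_self, Function.update_of_ne h2]
              rcases hw with hw | hw <;> subst hw <;> dsimp only at h6 ⊢ <;> omega
          · by_cases h2 : l' = i
            · have h8 := hst i' l' hil (by rw [h2]; exact fun e => h1 (hinj e))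
              have h6 := hi i'
              rw [h2] at h8
              rw [h2, Function.update_self, Function.update_of_ne h1]
              rcases hw with hw | hw <;> subst hw <;> dsimp only at h6 ⊢ <;> omega
            · rw [Function.update_of_ne h1, Function.update_of_ne h2]
              exact hu _ _ hil
        rw [cd_TT_step X u _ i (hnv i) hne,
          ihN _ (hsum _ (by dsimp only; omega)) (hCC _ (Or.inl rfl)),
          ihN _ (hsum _ (by dsimp only; omega)) (hCC _ (Or.inr rfl))]
        set A : Matrix (Fin (k + 1)) (Fin (k + 1)) ℝ :=
          Matrix.of fun i j => T1 X (u i) (m, y j) with hA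
        have hup : ∀ w : ℤ × ℤ, (Matrix.of fun i' j => T1 X (Function.update u i w i') (m, y j)) =
            A.updateRow i (fun j => T1 X w (m, y j)) := by
          intro w
          ext i' j
          by_cases h1 : i' = i
          · subst h1; simp
          · simp [Matrix.updateRow_ne h1, Function.update_of_ne h1, hA]
        rw [hup, hup, ← Matrix.det_updateRow_add, ← Matrix.det_updateRow_smul]
        congr 1
        ext i' j
        by_cases h1 : i' = i
        · subst h1
          simp only [Matrix.updateRow_self, Pi.smul_apply, Pi.add_apply, smul_eq_mul, hA,
            Matrix.of_apply]
          exact (cd_T1_step X _ _ (hnv j)).symm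
        · simp [Matrix.updateRow_ne h1]

lemma cd_path_neg {γ : List (ℤ × ℤ)} {u v : ℤ × ℤ} (h : IsDirPath UpStep γ u v) :
    IsDirPath UpStep (γ.reverse.map fun w => -w) (-v) (-u) := by
  obtain ⟨h1, h2, h3⟩ := h
  refine ⟨?_, ?_, ?_⟩
  · rw [List.head?_map, List.head?_reverse, h2]; rfl
  · rw [List.getLast?_map, List.getLast?_reverse, h1]; rfl
  · have h3' : List.IsChain UpStep γ := h3
    show List.IsChain UpStep _
    rw [List.isChain_map, List.isChain_reverse]
    refine h3'.imp ?_
    intro a b hab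
    simp only [UpStep, Prod.fst_neg, Prod.snd_neg] at hab ⊢
    omega

lemma cd_tuple_neg {k : ℕ} {u v : Fin k → ℤ × ℤ} {γ : Fin k → List (ℤ × ℤ)}
    (h : γ ∈ DisjointPathTuples UpStep u v) :
    (fun i => (γ i).reverse.map fun w => -w) ∈ DisjointPathTuples UpStep (-v) (-u) := by
  refine ⟨fun i => cd_path_neg (h.1 i), ?_⟩
  intro i j hij w hw hw'
  simp only [List.mem_map, List.mem_reverse] at hw hw'
  obtain ⟨w1, h1, rfl⟩ := hw
  obtain ⟨w2, h2, h3⟩ := hw'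
  have := neg_injective h3
  subst this
  exact h.2 i j hij _ h1 h2

lemma cd_TT_neg (X : ℤ × ℤ → ℝ) {k : ℕ} (u v : Fin k → ℤ × ℤ) :
    TT X u v = TT (fun w => X (-w)) (-v) (-u) := by
  classical
  rw [cd_TT_eq_sum, cd_TT_eq_sum]
  refine Finset.sum_nbij' (fun γ i => (γ i).reverse.map fun w => -w)
    (fun γ i => (γ i).reverse.map fun w => -w) ?_ ?_ ?_ ?_ ?_
  · intro γ hγ
    simp only [Set.Finite.mem_toFinset] at hγ ⊢
    exact cd_tuple_neg hγ
  · intro γ hγ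
    simp only [Set.Finite.mem_toFinset] at hγ ⊢
    simpa using cd_tuple_neg hγ
  · intro γ _; funext i; simp [List.map_reverse]
  · intro γ _; funext i; simp [List.map_reverse]
  · intro γ _
    unfold tupleWeight
    refine Finset.prod_nbij' (fun w => -w) (fun w => -w) ?_ ?_ ?_ ?_ ?_
    · intro w hw; simpa using hw
    · intro w hw
      simp only [Finset.mem_biUnion, Finset.mem_univ, List.mem_toFinset, true_and, List.mem_map,
        List.mem_reverse] at hw ⊢
      obtain ⟨i, w', h1, rfl⟩ := hw
      exact ⟨i, by simpa using h1⟩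
    · intro w _; simp
    · intro w _; simp
    · intro w _; simp

lemma cd_TT_sink (X : ℤ × ℤ → ℝ) {k : ℕ} (u v : Fin k → ℤ × ℤ) (i : Fin k)
    (hne : u i ≠ v i) (hmax : ∀ l, l ≠ i → ¬ v i ≤ v l) :
    TT X u v = X (v i) * (TT X u (Function.update v i ((v i).1 - 1, (v i).2)) +
      TT X u (Function.update v i ((v i).1, (v i).2 - 1))) := by
  have hup : ∀ w : ℤ × ℤ, -(Function.update v i w) = Function.update (-v) i (-w) := by
    intro w; funext l
    by_cases h : l = i
    · subst h; simp
    · simp [Function.update_of_ne h]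
  rw [cd_TT_neg X u v, cd_TT_step _ (-v) (-u) i (fun h => hne (neg_injective h.symm))
    (fun l hl h => hmax l hl (neg_le_neg_iff.1 h)), cd_TT_neg X u (Function.update v i _),
    cd_TT_neg X u (Function.update v i _), hup, hup]
  have e1 : ((-v) i).1 + 1 = -((v i).1 - 1) := by simp; ring
  have e2 : ((-v) i).2 + 1 = -((v i).2 - 1) := by simp; ring
  rw [e1, e2]
  simp

lemma cd_TT_zero_coll' (X : ℤ × ℤ → ℝ) {k : ℕ} (u v : Fin k → ℤ × ℤ) (i l : Fin k)
    (hil : i ≠ l) (h : v i = v l) : TT X u v = 0 :=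
  cd_TT_zero_of_empty X u v fun _ hγ =>
    hγ.2 i l hil (v i) (cd_last_mem (hγ.1 i)) (h ▸ cd_last_mem (hγ.1 l))

lemma cd_peel_left (X : ℤ × ℤ → ℝ) {k : ℕ} (u v v' : Fin k → ℤ × ℤ) (i l : Fin k)
    (hne : u i ≠ v i) (hmax : ∀ l, l ≠ i → ¬ v i ≤ v l) (hil : l ≠ i)
    (hl : v l = ((v i).1, (v i).2 - 1))
    (hv' : v' = Function.update v i ((v i).1 - 1, (v i).2)) :
    TT X u v = X (v i) * TT X u v' := by
  rw [cd_TT_sink X u v i hne hmax, hv', cd_TT_zero_coll' X u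
    (Function.update v i ((v i).1, (v i).2 - 1)) i l hil.symm
    (by rw [Function.update_self, Function.update_of_ne hil, hl]), add_zero]

lemma cd_peel_down (X : ℤ × ℤ → ℝ) {k : ℕ} (u v v' : Fin k → ℤ × ℤ) (i l : Fin k)
    (hne : u i ≠ v i) (hmax : ∀ l, l ≠ i → ¬ v i ≤ v l) (hil : l ≠ i)
    (hl : v l = ((v i).1 - 1, (v i).2))
    (hv' : v' = Function.update v i ((v i).1, (v i).2 - 1)) :
    TT X u v = X (v i) * TT X u v' := by
  rw [cd_TT_sink X u v i hne hmax, hv', cd_TT_zero_coll' X u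
    (Function.update v i ((v i).1 - 1, (v i).2)) i l hil.symm
    (by rw [Function.update_self, Function.update_of_ne hil, hl]), zero_add]

/-- Intermediate sinks, peeling columns. -/
def cdA (m n : ℤ) (K q t : ℕ) : Fin (K + 1) → ℤ × ℤ := fun i =>
  (if (i : ℕ) < t then m - q - 1 else max (m - q) (m - K + (i : ℕ)), n - (i : ℕ))

/-- Intermediate sinks, peeling rows. -/
def cdB (m n : ℤ) (K q t : ℕ) : Fin (K + 1) → ℤ × ℤ := fun i =>
  (m - K + (i : ℕ), if (i : ℕ) + t ≤ K then n - min (q : ℤ) (i : ℕ) else n - q - 1)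

lemma cdA_step (X : ℤ × ℤ → ℝ) (m n : ℤ) (K q t : ℕ) (hm : (K : ℤ) + 1 ≤ m)
    (h : t + q < K) :
    TT X (botList (K + 1)) (cdA m n K q t) =
      X (m - q, n - t) * TT X (botList (K + 1)) (cdA m n K q (t + 1)) := by
  have hv : cdA m n K q t ⟨t, by omega⟩ = (m - q, n - t) := by
    simp only [cdA, lt_irrefl, if_false, Prod.mk.injEq, and_true]; omega
  rw [← hv]
  apply cd_peel_left X _ _ _ ⟨t, by omega⟩ ⟨t + 1, by omega⟩
  · rw [hv]; simp only [botList, ne_eq, Prod.mk.injEq]; omega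
  · intro l hl
    rw [hv]
    have hl' : (l : ℕ) ≠ t := fun e => hl (Fin.ext e)
    simp only [cdA, Prod.mk_le_mk]
    split_ifs <;> omega
  · simp [Fin.ext_iff]
  · rw [hv]; simp only [cdA, Prod.mk.injEq]
    rw [if_neg (by omega)]
    push_cast
    omega
  · rw [hv]
    funext l
    by_cases hl : l = ⟨t, by omega⟩
    · subst hl
      rw [Function.update_self]
      simp [cdA]
    · have hl' : (l : ℕ) ≠ t := fun e => hl (Fin.ext e)
      rw [Function.update_of_ne hl]
      have : (l : ℕ) < t + 1 ↔ (l : ℕ) < t := by omega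
      simp [cdA, this]

lemma cdB_step (X : ℤ × ℤ → ℝ) (m n : ℤ) (K q t : ℕ) (hn : (K : ℤ) + 1 ≤ n)
    (h : t + q < K) :
    TT X (botList (K + 1)) (cdB m n K q t) =
      X (m - t, n - q) * TT X (botList (K + 1)) (cdB m n K q (t + 1)) := by
  have hv : cdB m n K q t ⟨K - t, by omega⟩ = (m - t, n - q) := by
    simp only [cdB, Prod.mk.injEq]
    rw [if_pos (by omega)]; omega
  rw [← hv]
  apply cd_peel_down X _ _ _ ⟨K - t, by omega⟩ ⟨K - t - 1, by omega⟩
  · rw [hv]; simp only [botList, ne_eq, Prod.mk.injEq]; omega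
  · intro l hl
    rw [hv]
    have hl' : (l : ℕ) ≠ K - t := fun e => hl (Fin.ext e)
    simp only [cdB, Prod.mk_le_mk]
    split_ifs <;> omega
  · simp only [ne_eq, Fin.mk.injEq]; omega
  · rw [hv]; simp only [cdB, Prod.mk.injEq]
    rw [if_pos (by omega)]
    omega
  · rw [hv]
    funext l
    by_cases hl : l = ⟨K - t, by omega⟩
    · subst hl
      rw [Function.update_self]
      simp only [cdB, Prod.mk.injEq]
      rw [if_neg (by omega)]
      omega
    · have hl' : (l : ℕ) ≠ K - t := fun e => hl (Fin.ext e)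
      rw [Function.update_of_ne hl]
      have : (l : ℕ) + (t + 1) ≤ K ↔ (l : ℕ) + t ≤ K := by omega
      simp [cdB, this]

lemma cdA_next (m n : ℤ) (K q : ℕ) (h : q ≤ K) : cdA m n K q (K - q) = cdA m n K (q + 1) 0 := by
  funext l
  simp only [cdA, Prod.mk.injEq, and_true]
  have := l.2
  split_ifs <;> push_cast <;> omega

lemma cdB_next (m n : ℤ) (K q : ℕ) (h : q ≤ K) : cdB m n K q (K - q) = cdB m n K (q + 1) 0 := by
  funext l
  simp only [cdB, Prod.mk.injEq, true_and]
  have := l.2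
  split_ifs <;> push_cast <;> omega

lemma cdA_prod (X : ℤ × ℤ → ℝ) (m n : ℤ) (K : ℕ) (hm : (K : ℤ) + 1 ≤ m) (q : ℕ) (hq : q ≤ K) :
    TT X (botList (K + 1)) (cdA m n K 0 0) =
      (∏ p ∈ Finset.range q, ∏ t ∈ Finset.range (K - p), X (m - p, n - t)) *
        TT X (botList (K + 1)) (cdA m n K q 0) := by
  induction q with
  | zero => simp
  | succ q ih =>
    rw [ih (by omega), Finset.prod_range_succ, mul_assoc, ← cdA_next m n K q (by omega)]
    congr 1
    have : ∀ s, s + q ≤ K → TT X (botList (K + 1)) (cdA m n K q 0) =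
        (∏ t ∈ Finset.range s, X (m - q, n - t)) * TT X (botList (K + 1)) (cdA m n K q s) := by
      intro s
      induction s with
      | zero => simp
      | succ s ih =>
        intro hs
        rw [ih (by omega), Finset.prod_range_succ, mul_assoc, cdA_step X m n K q s hm (by omega)]
    exact this (K - q) (by omega)

lemma cdB_prod (X : ℤ × ℤ → ℝ) (m n : ℤ) (K : ℕ) (hn : (K : ℤ) + 1 ≤ n) (q : ℕ) (hq : q ≤ K) :
    TT X (botList (K + 1)) (cdB m n K 0 0) =
      (∏ p ∈ Finset.range q, ∏ t ∈ Finset.range (K - p), X (m - t, n - p)) *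
        TT X (botList (K + 1)) (cdB m n K q 0) := by
  induction q with
  | zero => simp
  | succ q ih =>
    rw [ih (by omega), Finset.prod_range_succ, mul_assoc, ← cdB_next m n K q (by omega)]
    congr 1
    have : ∀ s, s + q ≤ K → TT X (botList (K + 1)) (cdB m n K q 0) =
        (∏ t ∈ Finset.range s, X (m - t, n - q)) * TT X (botList (K + 1)) (cdB m n K q s) := by
      intro s
      induction s with
      | zero => simp
      | succ s ih =>
        intro hs
        rw [ih (by omega), Finset.prod_range_succ, mul_assoc, cdB_step X m n K q s hn (by omega)]
    exact this (K - q) (by omega)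

lemma cd_Tk_eq (X : ℤ × ℤ → ℝ) (m n : ℤ) (K : ℕ) (hm : (K : ℤ) + 1 ≤ m) (hn : (K : ℤ) + 1 ≤ n) :
    Tk X (K + 1) (1, 1) (m, n) = TT X (botList (K + 1)) (topList m n (K + 1)) := by
  have hA : topList m n (K + 1) = cdA m n K 0 0 := by
    funext l
    have := l.2
    simp only [topList, cdA, Prod.mk.injEq, Nat.not_lt_zero, if_false, and_true]
    push_cast
    omega
  have hB : (fun i : Fin (K + 1) => ((m, n).1 + (i : ℕ) - (((K + 1 : ℕ) : ℤ) - 1), (m, n).2)) =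
      cdB m n K 0 0 := by
    funext l
    have := l.2
    simp only [cdB, Prod.mk.injEq]
    rw [if_pos (by omega)]
    push_cast
    omega
  have hAB : cdA m n K K 0 = cdB m n K K 0 := by
    funext l
    have := l.2
    simp only [cdA, cdB, Prod.mk.injEq, Nat.not_lt_zero, if_false]
    rw [if_pos (by omega)]
    omega
  have hu : (fun i : Fin (K + 1) => (((1 : ℤ), (1 : ℤ)).1 + (i : ℕ), ((1 : ℤ), (1 : ℤ)).2)) =
      botList (K + 1) := by
    funext l
    simp [botList, add_comm]
  unfold Tk
  rw [if_neg (by omega), hB, hu, hA, cdA_prod X m n K hm K le_rfl, cdB_prod X m n K hn K le_rfl,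
    hAB]
  congr 1
  apply Finset.prod_comm'
  intro x y
  simp only [Finset.mem_range]
  omega

lemma cd_Lpath (p : ℤ × ℤ) (q : ℤ × ℤ) (h : p ≤ q) : ∃ γ, IsDirPath UpStep γ p q ∧
    ∀ w ∈ γ, (w.1 = p.1 ∧ w.2 ≤ q.2) ∨ (w.2 = q.2 ∧ p.1 ≤ w.1) := by
  obtain ⟨N, hN⟩ : ∃ N : ℕ, (q.1 + q.2 - p.1 - p.2).toNat = N := ⟨_, rfl⟩
  induction N generalizing p with
  | zero =>
    rw [Prod.le_def] at h
    have : p = q := Prod.ext (by omega) (by omega)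
    subst this
    exact ⟨[p], cd_path_singleton p, by simp⟩
  | succ N ih =>
    rw [Prod.le_def] at h
    by_cases h2 : p.2 < q.2
    · obtain ⟨γ, h1, h3⟩ := ih (p.1, p.2 + 1) (by rw [Prod.le_def]; dsimp only; omega)
        (by dsimp only; omega)
      refine ⟨p :: γ, cd_path_cons (u' := (p.1, p.2 + 1)) (Or.inr ⟨rfl, rfl⟩) h1, ?_⟩
      intro w hw
      rcases List.mem_cons.1 hw with rfl | hw
      · omega
      · have := h3 w hw; dsimp only at this; omega
    · obtain ⟨γ, h1, h3⟩ := ih (p.1 + 1, p.2) (by rw [Prod.le_def]; dsimp only; omega)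
        (by dsimp only; omega)
      refine ⟨p :: γ, cd_path_cons (u' := (p.1 + 1, p.2)) (Or.inl ⟨rfl, rfl⟩) h1, ?_⟩
      intro w hw
      rcases List.mem_cons.1 hw with rfl | hw
      · omega
      · have := (cd_path_bounds h1 w hw)
        rw [Prod.le_def, Prod.le_def] at this
        dsimp only at this; omega

lemma cd_pos (X : ℤ × ℤ → ℝ) (hX : ∀ w, 0 < X w) (m n : ℤ) (k : ℕ) (hm : (k : ℤ) ≤ m)
    (hn : (k : ℤ) ≤ n) : 0 < TT X (botList k) (topList m n k) := by
  have hw : ∀ γ : Fin k → List (ℤ × ℤ), 0 < tupleWeight X γ :=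
    fun γ => Finset.prod_pos fun w _ => hX w
  rw [cd_TT_eq_sum]
  apply Finset.sum_pos (fun γ _ => hw γ)
  have hex : ∀ i : Fin k, ∃ γ, IsDirPath UpStep γ (botList k i) (topList m n k i) ∧
      ∀ w ∈ γ, (w.1 = (botList k i).1 ∧ w.2 ≤ (topList m n k i).2) ∨
        (w.2 = (topList m n k i).2 ∧ (botList k i).1 ≤ w.1) := by
    intro i
    apply cd_Lpath
    have := i.2
    simp only [botList, topList, Prod.mk_le_mk]
    omega
  choose γ h1 h2 using hex
  refine ⟨γ, ?_⟩
  rw [Set.Finite.mem_toFinset]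
  refine ⟨h1, ?_⟩
  intro i j hij w hw hw'
  have e1 := h2 i w hw
  have e2 := h2 j w hw'
  have : (i : ℕ) ≠ j := fun e => hij (Fin.ext e)
  simp only [botList, topList] at e1 e2
  omega

/-- Successive Schur complements (Gaussian elimination). -/
noncomputable def cdG {α β : Type*} (f : α → β → ℝ) (r : ℕ → α) (c : ℕ → β) : ℕ → α → β → ℝ
  | 0 => f
  | k + 1 => fun a b => cdG f r c k a b -
      cdG f r c k a (c k) * cdG f r c k (r k) b / cdG f r c k (r k) (c k)

lemma cdG_shift {α β : Type*} (f : α → β → ℝ) (r : ℕ → α) (c : ℕ → β) (k : ℕ) :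
    cdG f r c (k + 1) = cdG (cdG f r c 1) (fun i => r (i + 1)) (fun i => c (i + 1)) k := by
  induction k with
  | zero => rfl
  | succ k ih =>
    funext a b
    show cdG f r c (k + 1) a b - cdG f r c (k + 1) a (c (k + 1)) *
      cdG f r c (k + 1) (r (k + 1)) b / cdG f r c (k + 1) (r (k + 1)) (c (k + 1)) = _
    rw [ih]
    rfl

lemma cd_pivot {N : ℕ} (A : Matrix (Fin (N + 1)) (Fin (N + 1)) ℝ) (h : A 0 0 ≠ 0) :
    A.det = A 0 0 * Matrix.det (Matrix.of fun i j : Fin N =>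
      A i.succ j.succ - A i.succ 0 * A 0 j.succ / A 0 0) := by
  set c : Fin (N + 1) → ℝ := fun i => if i = 0 then 0 else A i 0 / A 0 0 with hc
  set B : Matrix (Fin (N + 1)) (Fin (N + 1)) ℝ := Matrix.of fun i j => A i j - c i * A 0 j with hB
  have hB0 : ∀ j, B 0 j = A 0 j := by intro j; simp [hB, hc]
  have hdet : A.det = B.det := by
    apply Matrix.det_eq_of_forall_row_eq_smul_add_const c 0 (by simp [hc])
    intro i j
    rw [hB0]; simp [hB]
  rw [hdet, Matrix.det_succ_column_zero, Fin.sum_univ_succ, Finset.sum_eq_zero]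
  · rw [hB0, add_zero]
    simp only [Fin.val_zero, pow_zero, one_mul]
    congr 2
    ext i j
    simp only [hB, hc, Matrix.submatrix_apply, Matrix.of_apply, Fin.succAbove_zero,
      Fin.succ_ne_zero, if_false]
    ring
  · intro i _
    have : B i.succ 0 = 0 := by
      simp only [hB, hc, Matrix.of_apply, Fin.succ_ne_zero, if_false]
      field_simp
      ring
    rw [this]; ring

lemma cd_det {α β : Type*} (k : ℕ) : ∀ (f : α → β → ℝ) (r : ℕ → α) (c : ℕ → β) (a : α) (b : β),
    (∀ i < k, cdG f r c i (r i) (c i) ≠ 0) →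
    Matrix.det (Matrix.of fun i j : Fin (k + 1) =>
      f (if (i : ℕ) < k then r i else a) (if (j : ℕ) < k then c j else b)) =
      (∏ i ∈ Finset.range k, cdG f r c i (r i) (c i)) * cdG f r c k a b := by
  induction k with
  | zero => intro f r c a b _; simp [cdG]
  | succ k ih =>
    intro f r c a b h
    rw [cd_pivot _ (by simpa [cdG] using h 0 (by omega)), Finset.prod_range_succ', cdG_shift]
    have h' := ih (cdG f r c 1) (fun i => r (i + 1)) (fun i => c (i + 1)) a b (by
      intro i hi
      rw [← cdG_shift]
      exact h (i + 1) (by omega))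
    simp only [← cdG_shift f r c] at h'
    rw [← cdG_shift, mul_right_comm, ← h', mul_comm]
    congr 1
    congr 1
    ext i j
    simp [cdG]

lemma cd_startList_eq (k : ℕ) (a : ℤ) : startList a (k + 1) =
    fun i : Fin (k + 1) => (if (i : ℕ) < k then ((i : ℕ) : ℤ) + 1 else a, (1 : ℤ)) := by
  funext i
  have := i.2
  simp only [startList]
  split_ifs <;> first | rfl | omega

lemma cd_endList_eq (m n : ℤ) (k : ℕ) (b : ℤ) : endList m n b (k + 1) =
    fun i : Fin (k + 1) => (m, if (i : ℕ) < k then n - ((i : ℕ) : ℤ) else b) := by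
  funext i
  have := i.2
  simp only [endList]
  split_ifs <;> first | rfl | omega

lemma cd_botList_eq (k : ℕ) : botList (k + 1) = startList ((k : ℤ) + 1) (k + 1) := by
  funext i
  simp only [startList, botList]
  split_ifs with h
  · rw [Prod.mk.injEq]; exact ⟨by omega, rfl⟩
  · rfl

lemma cd_topList_eq (m n : ℤ) (k : ℕ) : topList m n (k + 1) = endList m n (n - k) (k + 1) := by
  funext i
  simp only [endList, topList]
  split_ifs with h
  · rw [Prod.mk.injEq]; exact ⟨rfl, by omega⟩
  · rfl

lemma cd_TT_det (X : ℤ × ℤ → ℝ) (m n : ℤ) (k : ℕ) (a b : ℤ) (ha : (k : ℤ) + 1 ≤ a)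
    (hb : b ≤ n - k) : TT X (startList a (k + 1)) (endList m n b (k + 1)) =
    Matrix.det (Matrix.of fun i j : Fin (k + 1) => (fun x y : ℤ => T1 X (x, 1) (m, y))
      (if (i : ℕ) < k then (fun i : ℕ => (i : ℤ) + 1) i else a)
      (if (j : ℕ) < k then (fun j : ℕ => n - (j : ℤ)) j else b)) := by
  rw [cd_startList_eq, cd_endList_eq, cd_LGV]
  · intro i l hil
    have h1 : (i : ℕ) < l := hil
    have := l.2
    split_ifs <;> omega
  · intro i l hil
    have h1 : (i : ℕ) ≤ l := hil
    have := l.2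
    refine ⟨?_, le_rfl⟩
    dsimp only
    split_ifs <;> omega

/-- **Crossing decomposition, general form** (Lemma `cross-line`, eq. (cl2)).
For strictly positive weights, `1 ≤ j ≤ a ≤ m`, `1 ≤ b ≤ n - j + 1`:
`T([(1,1)^{j-1},(a,1)],[(m,n)^{j-1},(m,b)]) / T_{j-1}((1,1),(m,n))
  = Σ_{k=j}^{min(a,n-b+1)} T([(1,1)^{k-1},(a,1)],[(m,n)^k]) ⬝ T([(1,1)^k],[(m,n)^{k-1},(m,b)])
      / (T_k((1,1),(m,n)) ⬝ T_{k-1}((1,1),(m,n)))`. -/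
theorem crossing_decomposition_general (X : ℤ × ℤ → ℝ) (hX : ∀ w, 0 < X w)
    (m n : ℤ) (hm : 1 ≤ m) (hn : 1 ≤ n) (j a b : ℤ)
    (hj1 : 1 ≤ j) (hja : j ≤ a) (ham : a ≤ m) (hb1 : 1 ≤ b) (hbn : b ≤ n - j + 1) :
    TT X (startList a j.toNat) (endList m n b j.toNat) / Tk X (j - 1).toNat (1, 1) (m, n) =
      ∑ k ∈ Finset.Icc j (min a (n - b + 1)),
        TT X (startList a k.toNat) (topList m n k.toNat) *
          TT X (botList k.toNat) (endList m n b k.toNat) /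
          (Tk X k.toNat (1, 1) (m, n) * Tk X (k - 1).toNat (1, 1) (m, n)) := by
  set G : ℕ → ℤ → ℤ → ℝ := cdG (fun x y : ℤ => T1 X (x, 1) (m, y))
    (fun i : ℕ => (i : ℤ) + 1) (fun j : ℕ => n - (j : ℤ)) with hG
  have hGs : ∀ (k : ℕ) (a b : ℤ), G (k + 1) a b =
      G k a b - G k a (n - k) * G k (k + 1) b / G k (k + 1) (n - k) := fun k a b => rfl
  -- pivots are nonzero
  have hpiv : ∀ k : ℕ, (k : ℤ) + 1 ≤ m → (k : ℤ) + 1 ≤ n → G k (k + 1) (n - k) ≠ 0 := by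
    intro k
    induction k using Nat.strong_induction_on with
    | _ k ih =>
      intro h1 h2 h0
      have hp := cd_pos X hX m n (k + 1) (by push_cast; omega) (by push_cast; omega)
      rw [cd_botList_eq, cd_topList_eq, cd_TT_det X m n k _ _ le_rfl le_rfl,
        cd_det k _ _ _ _ _ (fun i hi => ih i hi (by omega) (by omega)), ← hG, h0,
        mul_zero] at hp
      exact lt_irrefl _ hp
  set P : ℕ → ℝ := fun k => ∏ i ∈ Finset.range k, G i (i + 1) (n - i) with hP
  have hPne : ∀ k : ℕ, (k : ℤ) ≤ m → (k : ℤ) ≤ n → P k ≠ 0 := by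
    intro k h1 h2
    rw [hP]
    apply Finset.prod_ne_zero_iff.2
    intro i hi
    rw [Finset.mem_range] at hi
    exact hpiv i (by omega) (by omega)
  have hD : ∀ (k : ℕ) (a b : ℤ), (k : ℤ) ≤ m → (k : ℤ) ≤ n → Matrix.det (Matrix.of
      fun i j : Fin (k + 1) => (fun x y : ℤ => T1 X (x, 1) (m, y))
      (if (i : ℕ) < k then (fun i : ℕ => (i : ℤ) + 1) i else a)
      (if (j : ℕ) < k then (fun j : ℕ => n - (j : ℤ)) j else b)) = P k * G k a b := by
    intro k a b h1 h2
    exact cd_det k _ _ _ a b (fun i hi => hpiv i (by omega) (by omega))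
  have hT : ∀ (k : ℕ) (a b : ℤ), (k : ℤ) + 1 ≤ a → b ≤ n - k → (k : ℤ) ≤ m → (k : ℤ) ≤ n →
      TT X (startList a (k + 1)) (endList m n b (k + 1)) = P k * G k a b := by
    intro k a b h1 h2 h3 h4
    rw [cd_TT_det X m n k a b h1 h2, hD k a b h3 h4]
  have hTk : ∀ k : ℕ, (k : ℤ) ≤ m → (k : ℤ) ≤ n → Tk X k (1, 1) (m, n) = P k := by
    intro k h1 h2
    cases k with
    | zero => simp [Tk, hP]
    | succ k =>
      push_cast at h1 h2
      rw [cd_Tk_eq X m n k h1 h2, cd_botList_eq, cd_topList_eq,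
        hT k _ _ le_rfl le_rfl (by omega) (by omega)]
      simp only [hP]
      rw [Finset.prod_range_succ]
  -- vanishing at the end
  have hzero : ∀ K : ℕ, 1 ≤ K → (K : ℤ) = min a (n - b + 1) → G K a b = 0 := by
    intro K hK1 hK
    have h0 := hD K a b (by omega) (by omega)
    have hne := hPne K (by omega) (by omega)
    have hdet : Matrix.det (Matrix.of
      fun i j : Fin (K + 1) => (fun x y : ℤ => T1 X (x, 1) (m, y))
      (if (i : ℕ) < K then (fun i : ℕ => (i : ℤ) + 1) i else a)
      (if (j : ℕ) < K then (fun j : ℕ => n - (j : ℤ)) j else b)) = 0 := by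
      have hne2 : (⟨K - 1, by omega⟩ : Fin (K + 1)) ≠ ⟨K, by omega⟩ := by
        simp only [ne_eq, Fin.mk.injEq]; omega
      rcases le_total a (n - b + 1) with h | h
      · apply Matrix.det_zero_of_row_eq hne2
        funext j
        have e : ((K - 1 : ℕ) : ℤ) + 1 = a := by omega
        simp only [Matrix.of_apply, lt_irrefl, if_false]
        rw [if_pos (by omega), e]
      · apply Matrix.det_zero_of_column_eq hne2
        intro j
        have e : n - ((K - 1 : ℕ) : ℤ) = b := by omega
        simp only [Matrix.of_apply, lt_irrefl, if_false]
        rw [if_pos (show K - 1 < K by omega), e]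
    rw [hdet] at h0
    rcases mul_eq_zero.1 h0.symm with h | h
    · exact absurd h hne
    · exact h
  -- each summand telescopes
  have hterm : ∀ k : ℕ, (k : ℤ) + 1 ≤ a → (k : ℤ) + 1 ≤ n - b + 1 →
      TT X (startList a ((k : ℤ) + 1).toNat) (topList m n ((k : ℤ) + 1).toNat) *
          TT X (botList ((k : ℤ) + 1).toNat) (endList m n b ((k : ℤ) + 1).toNat) /
          (Tk X ((k : ℤ) + 1).toNat (1, 1) (m, n) * Tk X ((k : ℤ) + 1 - 1).toNat (1, 1) (m, n)) =
        G k a b - G (k + 1) a b := by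
    intro k h1 h2
    have e1 : ((k : ℤ) + 1).toNat = k + 1 := by omega
    have e2 : ((k : ℤ) + 1 - 1).toNat = k := by omega
    rw [e1, e2, hTk (k + 1) (by push_cast; omega) (by push_cast; omega),
      hTk k (by omega) (by omega), cd_botList_eq, cd_topList_eq,
      hT k _ _ h1 le_rfl (by omega) (by omega),
      hT k _ _ le_rfl (by omega) (by omega) (by omega), hGs]
    have hp1 : P (k + 1) = P k * G k (k + 1) (n - k) := by
      simp only [hP]; rw [Finset.prod_range_succ]
    have hp2 := hpiv k (by omega) (by omega)
    have hp3 := hPne k (by omega) (by omega)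
    rw [hp1]
    field_simp
    ring
  obtain ⟨J, rfl⟩ : ∃ J : ℕ, j = (J : ℤ) + 1 := ⟨(j - 1).toNat, by omega⟩
  have htel : ∀ d : ℕ, (J : ℤ) + d ≤ min a (n - b + 1) →
      ∑ k ∈ Finset.Icc ((J : ℤ) + 1) (J + d),
        TT X (startList a k.toNat) (topList m n k.toNat) *
          TT X (botList k.toNat) (endList m n b k.toNat) /
          (Tk X k.toNat (1, 1) (m, n) * Tk X (k - 1).toNat (1, 1) (m, n)) =
        G J a b - G (J + d) a b := by
    intro d
    induction d with
    | zero => intro _; simp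
    | succ d ih =>
      intro hd
      push_cast at hd
      have hI : Finset.Icc ((J : ℤ) + 1) (J + (d + 1 : ℕ)) =
          insert (((J + d : ℕ) : ℤ) + 1) (Finset.Icc ((J : ℤ) + 1) (J + d)) := by
        ext x
        simp only [Finset.mem_Icc, Finset.mem_insert]
        push_cast
        omega
      rw [hI, Finset.sum_insert (by simp only [Finset.mem_Icc]; push_cast; omega),
        ih (by omega), hterm (J + d) (by push_cast; omega) (by push_cast; omega),
        show J + (d + 1) = J + d + 1 by omega]
      ring
  obtain ⟨d, hd⟩ : ∃ d : ℕ, min a (n - b + 1) = (J : ℤ) + d :=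
    ⟨(min a (n - b + 1) - J).toNat, by omega⟩
  rw [hd, htel d hd.ge, hzero (J + d) (by omega) (by push_cast; omega)]
  have e1 : ((J : ℤ) + 1).toNat = J + 1 := by omega
  have e2 : ((J : ℤ) + 1 - 1).toNat = J := by omega
  have hp3 := hPne J (by omega) (by omega)
  rw [e1, e2, hTk J (by omega) (by omega), hT J a b hja (by omega) (by omega) (by omega)]
  field_simp
  ring
end
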